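/- arXiv:1712.09499 — 2 statements merged into one kernel-verified Lean document; each statement's English description precedes it below -/
import Mathlib

section
/- Let A ⊆ C be a unital inclusion of unital C*-algebras with A' ∩ C = C·1 and let E^A: C → A be a conditional expectation of Watatani index-finite type with C*-basic construction C_1. Then the map f: Pic(A,C) → Pic(C,C_1) defined by f([X,Y]) = [Y, Y_1], where Y_1 is the upward basic construction of Y for the unique conditional expectation E^X: Y → X with respect to E^A and E^A, is a well-defined group homomorphism. -/
open scoped MultiplierAlgebra

noncomputable section

structure EquivBimodule (C D Y : Type*)
    [NonUnitalCStarAlgebra C] [PartialOrder C] [StarOrderedRing C]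
    [NonUnitalCStarAlgebra D] [PartialOrder D] [StarOrderedRing D]
    [NormedAddCommGroup Y] [NormedSpace ℂ Y] [CompleteSpace Y] : Type _ where
  lsmul : C → Y → Y
  rsmul : Y → D → Y
  linn : Y → Y → C
  rinn : Y → Y → D
  lsmul_add : ∀ c x y, lsmul c (x + y) = lsmul c x + lsmul c y
  add_lsmul : ∀ c c' x, lsmul (c + c') x = lsmul c x + lsmul c' x
  mul_lsmul : ∀ c c' x, lsmul (c * c') x = lsmul c (lsmul c' x)
  smul_lsmul : ∀ (z : ℂ) c x, lsmul (z • c) x = z • lsmul c x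
  lsmul_smul : ∀ (z : ℂ) c x, lsmul c (z • x) = z • lsmul c x
  add_rsmul : ∀ x y d, rsmul (x + y) d = rsmul x d + rsmul y d
  rsmul_add : ∀ x d d', rsmul x (d + d') = rsmul x d + rsmul x d'
  rsmul_mul : ∀ x d d', rsmul x (d * d') = rsmul (rsmul x d) d'
  rsmul_smul : ∀ (z : ℂ) x d, rsmul (z • x) d = z • rsmul x d
  smul_rsmul : ∀ (z : ℂ) x d, rsmul x (z • d) = z • rsmul x d
  lsmul_rsmul : ∀ c x d, rsmul (lsmul c x) d = lsmul c (rsmul x d)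
  linn_add_left : ∀ x y z, linn (x + y) z = linn x z + linn y z
  linn_smul_left : ∀ (t : ℂ) x y, linn (t • x) y = t • linn x y
  linn_star : ∀ x y, star (linn x y) = linn y x
  linn_lsmul_left : ∀ c x y, linn (lsmul c x) y = c * linn x y
  linn_nonneg : ∀ x, 0 ≤ linn x x
  linn_definite : ∀ x, linn x x = 0 → x = 0
  rinn_add_right : ∀ x y z, rinn x (y + z) = rinn x y + rinn x z
  rinn_smul_right : ∀ (t : ℂ) x y, rinn x (t • y) = t • rinn x y
  rinn_star : ∀ x y, star (rinn x y) = rinn y x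
  rinn_rsmul_right : ∀ x y d, rinn x (rsmul y d) = rinn x y * d
  rinn_nonneg : ∀ x, 0 ≤ rinn x x
  rinn_definite : ∀ x, rinn x x = 0 → x = 0
  imprimitivity : ∀ x y z, lsmul (linn x y) z = rsmul x (rinn y z)
  norm_linn : ∀ x, ‖linn x x‖ = ‖x‖ ^ 2
  norm_rinn : ∀ x, ‖rinn x x‖ = ‖x‖ ^ 2
  full_left : Dense (Submodule.span ℂ {c : C | ∃ x y, c = linn x y} : Set C)
  full_right : Dense (Submodule.span ℂ {d : D | ∃ x y, d = rinn x y} : Set D)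

namespace EquivBimodule

variable {C D Y W : Type*}
    [NonUnitalCStarAlgebra C] [PartialOrder C] [StarOrderedRing C]
    [NonUnitalCStarAlgebra D] [PartialOrder D] [StarOrderedRing D]
    [NormedAddCommGroup Y] [NormedSpace ℂ Y] [CompleteSpace Y]
    [NormedAddCommGroup W] [NormedSpace ℂ W] [CompleteSpace W]

structure Iso (E : EquivBimodule C D Y) (F : EquivBimodule C D W) where
  toEquiv : Y ≃ₗ[ℂ] W
  map_lsmul : ∀ c y, toEquiv (E.lsmul c y) = F.lsmul c (toEquiv y)
  map_rsmul : ∀ y d, toEquiv (E.rsmul y d) = F.rsmul (toEquiv y) d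
  map_linn : ∀ x y, F.linn (toEquiv x) (toEquiv y) = E.linn x y
  map_rinn : ∀ x y, F.rinn (toEquiv x) (toEquiv y) = E.rinn x y

end EquivBimodule

def DenseIncl {A C : Type*} [NonUnitalCStarAlgebra C] (ι : A → C) : Prop :=
  Dense (Submodule.span ℂ {x : C | ∃ (a : A) (c : C), x = ι a * c} : Set C)

structure IsMoritaIncl {A B C D Y : Type*}
    [NonUnitalCStarAlgebra C] [PartialOrder C] [StarOrderedRing C]
    [NonUnitalCStarAlgebra D] [PartialOrder D] [StarOrderedRing D]
    [NormedAddCommGroup Y] [NormedSpace ℂ Y] [CompleteSpace Y]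
    (ιA : A → C) (ιB : B → D)
    (E : EquivBimodule C D Y) (X : Submodule ℂ Y) : Prop where
  closed : IsClosed (X : Set Y)
  lsmul_mem : ∀ (a : A), ∀ x ∈ X, E.lsmul (ιA a) x ∈ X
  rsmul_mem : ∀ (b : B), ∀ x ∈ X, E.rsmul x (ιB b) ∈ X
  linn_mem : ∀ x ∈ X, ∀ y ∈ X, E.linn x y ∈ Set.range ιA
  rinn_mem : ∀ x ∈ X, ∀ y ∈ X, E.rinn x y ∈ Set.range ιB
  span_XX_left :
    closure (Submodule.span ℂ {c : C | ∃ x ∈ X, ∃ y ∈ X, c = E.linn x y} : Set C) = Set.range ιA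
  span_YX_left :
    Dense (Submodule.span ℂ {c : C | ∃ (y : Y), ∃ x ∈ X, c = E.linn y x} : Set C)
  span_XX_right :
    closure (Submodule.span ℂ {d : D | ∃ x ∈ X, ∃ y ∈ X, d = E.rinn x y} : Set D) = Set.range ιB
  span_YX_right :
    Dense (Submodule.span ℂ {d : D | ∃ (y : Y), ∃ x ∈ X, d = E.rinn y x} : Set D)

abbrev IsEquiPair {A C Y : Type*}
    [NonUnitalCStarAlgebra C] [PartialOrder C] [StarOrderedRing C]
    [NormedAddCommGroup Y] [NormedSpace ℂ Y] [CompleteSpace Y]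
    (ι : A → C) (E : EquivBimodule C C Y) (X : Submodule ℂ Y) : Prop :=
  IsMoritaIncl ι ι E X

def PairEquiv {C D Y W : Type*}
    [NonUnitalCStarAlgebra C] [PartialOrder C] [StarOrderedRing C]
    [NonUnitalCStarAlgebra D] [PartialOrder D] [StarOrderedRing D]
    [NormedAddCommGroup Y] [NormedSpace ℂ Y] [CompleteSpace Y]
    [NormedAddCommGroup W] [NormedSpace ℂ W] [CompleteSpace W]
    (E : EquivBimodule C D Y) (X : Submodule ℂ Y)
    (F : EquivBimodule C D W) (Z : Submodule ℂ W) : Prop :=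
  ∃ Φ : E.Iso F, X.map Φ.toEquiv.toLinearMap = Z

def IsTrivialData {C : Type*}
    [NonUnitalCStarAlgebra C] [PartialOrder C] [StarOrderedRing C]
    (T : EquivBimodule C C C) : Prop :=
  T.lsmul = (fun c x => c * x) ∧ T.rsmul = (fun x c => x * c) ∧
    T.linn = (fun x y => x * star y) ∧ T.rinn = (fun x y => star x * y)

/-- The data of the equivalence bimodule `Y_σ` induced by an automorphism with
underlying map `σ` (with inverse `σinv`). -/
def IsAlphaData {C : Type*}
    [NonUnitalCStarAlgebra C] [PartialOrder C] [StarOrderedRing C]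
    (σ σinv : C → C) (T : EquivBimodule C C C) : Prop :=
  T.lsmul = (fun c x => c * x) ∧ T.rsmul = (fun x c => x * σ c) ∧
    T.linn = (fun x y => x * star y) ∧ T.rinn = (fun x y => σinv (star x * y))

/-- The submodule `{ι a | a : A}` of `C`, e.g. the subspace `X_α = A` of `Y_α = C`. -/
def rangeSub {A C : Type*} [NonUnitalCStarAlgebra C]
    (ι : A → C) : Submodule ℂ C :=
  Submodule.span ℂ (Set.range ι)

/-- A realization of the interior tensor product `Y ⊗_D W` of equivalence bimodules. -/
structure IsTensorProd {C D L Y W V : Type*}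
    [NonUnitalCStarAlgebra C] [PartialOrder C] [StarOrderedRing C]
    [NonUnitalCStarAlgebra D] [PartialOrder D] [StarOrderedRing D]
    [NonUnitalCStarAlgebra L] [PartialOrder L] [StarOrderedRing L]
    [NormedAddCommGroup Y] [NormedSpace ℂ Y] [CompleteSpace Y]
    [NormedAddCommGroup W] [NormedSpace ℂ W] [CompleteSpace W]
    [NormedAddCommGroup V] [NormedSpace ℂ V] [CompleteSpace V]
    (E : EquivBimodule C D Y) (G : EquivBimodule D L W)
    (F : EquivBimodule C L V) (s : Y → W → V) : Prop where
  add_left : ∀ y y' w, s (y + y') w = s y w + s y' w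
  smul_left : ∀ (z : ℂ) y w, s (z • y) w = z • s y w
  add_right : ∀ y w w', s y (w + w') = s y w + s y w'
  smul_right : ∀ (z : ℂ) y w, s y (z • w) = z • s y w
  balanced : ∀ y d w, s (E.rsmul y d) w = s y (G.lsmul d w)
  map_lsmul : ∀ c y w, F.lsmul c (s y w) = s (E.lsmul c y) w
  map_rsmul : ∀ y w l, F.rsmul (s y w) l = s y (G.rsmul w l)
  map_linn : ∀ y y' w w',
    F.linn (s y w) (s y' w') = E.linn (E.rsmul y (G.linn w w')) y'
  map_rinn : ∀ y y' w w',
    F.rinn (s y w) (s y' w') = G.rinn w (G.lsmul (E.rinn y y') w')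
  dense : Dense (Submodule.span ℂ {v : V | ∃ y w, v = s y w} : Set V)

/-- A realization of the product of two elements of `Equi(A, C)`:
the tensor product bimodule together with the distinguished subspace `X₁ ⊗ X₂`. -/
structure IsPairTensor {A C Y W V : Type*}
    [NonUnitalCStarAlgebra C] [PartialOrder C] [StarOrderedRing C]
    [NormedAddCommGroup Y] [NormedSpace ℂ Y] [CompleteSpace Y]
    [NormedAddCommGroup W] [NormedSpace ℂ W] [CompleteSpace W]
    [NormedAddCommGroup V] [NormedSpace ℂ V] [CompleteSpace V]
    (ι : A → C)
    (E₁ : EquivBimodule C C Y) (X₁ : Submodule ℂ Y)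
    (E₂ : EquivBimodule C C W) (X₂ : Submodule ℂ W)
    (G : EquivBimodule C C V) (XV : Submodule ℂ V) (s : Y → W → V) : Prop where
  tensor : IsTensorProd E₁ E₂ G s
  sub : (XV : Set V) =
    closure (Submodule.span ℂ {v : V | ∃ x ∈ X₁, ∃ z ∈ X₂, v = s x z} : Set V)

section Multiplier

variable {C : Type*} [NonUnitalCStarAlgebra C]

/-- Conjugation `c ↦ u c u*` by a (unitary) multiplier `u ∈ M(C)`. -/
def mAd (u : 𝓜(ℂ, C)) (c : C) : C := u.fst ((star u).snd c)

/-- `m ∈ M(C)` is (the extension of) a multiplier of the subalgebra `A` (realized by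
`ι : A → C`): it maps `A` into `A` on both sides.  When `AC` is dense in `C`, the
multiplier algebra `M(A)` is exactly the set of such multipliers. -/
def IsMultiplierOf {A : Type*} (ι : A → C) (m : 𝓜(ℂ, C)) : Prop :=
  (∀ a : A, m.fst (ι a) ∈ Set.range ι) ∧ (∀ a : A, m.snd (ι a) ∈ Set.range ι)

/-- `u ∈ K(M(C))`: a unitary multiplier with `u a u*, u* a u ∈ A` for all `a ∈ A`. -/
def mem_KMC {A : Type*} (ι : A → C) (u : 𝓜(ℂ, C)) : Prop :=
  u ∈ unitary 𝓜(ℂ, C) ∧ (∀ a : A, mAd u (ι a) ∈ Set.range ι) ∧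
    (∀ a : A, mAd (star u) (ι a) ∈ Set.range ι)

/-- The subspace `Au = {a u | a ∈ A}` of `C`, for a multiplier `u ∈ M(C)`. -/
def AuSub {A : Type*} (ι : A → C) (u : 𝓜(ℂ, C)) : Submodule ℂ C :=
  Submodule.span ℂ {x : C | ∃ a : A, x = u.snd (ι a)}

end Multiplier

/-- A positive element `h` with `hA` dense in `A`; a C*-algebra is σ-unital iff it
possesses such a (strictly positive) element. -/
def SigmaUnital (A : Type*) [NonUnitalCStarAlgebra A] [PartialOrder A]
    [StarOrderedRing A] : Prop :=
  ∃ h : A, 0 ≤ h ∧ Dense (Set.range fun a : A => h * a)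

/-- A system of matrix units over `C` realizing `Cs` as the stabilization `C ⊗ K`. -/
structure IsStabilization {C Cs : Type*} [NonUnitalCStarAlgebra C]
    [NonUnitalCStarAlgebra Cs] (e : ℕ → ℕ → C → Cs) : Prop where
  map_add : ∀ i j c c', e i j (c + c') = e i j c + e i j c'
  map_smul : ∀ i j (z : ℂ) c, e i j (z • c) = z • e i j c
  map_mul : ∀ i j k l c d, e i j c * e k l d = if j = k then e i l (c * d) else 0
  map_star : ∀ i j c, star (e i j c) = e j i (star c)
  isometry : ∀ i j c, ‖e i j c‖ = ‖c‖
  dense : Dense (Submodule.span ℂ {x : Cs | ∃ i j c, x = e i j c} : Set Cs)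

section Unital

variable {A B C D : Type*} [CStarAlgebra A] [CStarAlgebra B] [CStarAlgebra C] [CStarAlgebra D]
  [PartialOrder C] [StarOrderedRing C] [PartialOrder D] [StarOrderedRing D]

/-- A conditional expectation from `C` onto `A`, for a unital inclusion realized by
`ι : A →⋆ₐ[ℂ] C`. -/
structure CondExpectation [PartialOrder A] [StarOrderedRing A] (ι : A →⋆ₐ[ℂ] C) where
  toFun : C → A
  map_add : ∀ x y, toFun (x + y) = toFun x + toFun y
  map_smul : ∀ (z : ℂ) x, toFun (z • x) = z • toFun x
  map_star : ∀ x, toFun (star x) = star (toFun x)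
  retraction : ∀ a, toFun (ι a) = a
  left_mod : ∀ a c, toFun (ι a * c) = a * toFun c
  right_mod : ∀ c a, toFun (c * ι a) = toFun c * a
  pos : ∀ c, 0 ≤ toFun (star c * c)

/-- A quasi-basis for a conditional expectation, in the sense of Watatani. -/
def IsQuasiBasis [PartialOrder A] [StarOrderedRing A] {ι : A →⋆ₐ[ℂ] C}
    (E : CondExpectation ι) {n : ℕ} (u : Fin n → C) : Prop :=
  ∀ c : C, (∑ i, u i * ι (E.toFun (star (u i) * c)) = c) ∧
    (∑ i, ι (E.toFun (c * u i)) * star (u i) = c)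

/-- A conditional expectation is of Watatani index-finite type if it admits a
quasi-basis. -/
def FiniteIndex [PartialOrder A] [StarOrderedRing A] {ι : A →⋆ₐ[ℂ] C}
    (E : CondExpectation ι) : Prop :=
  ∃ (n : ℕ) (u : Fin n → C), IsQuasiBasis E u

/-- `A' ∩ C = ℂ 1` for the inclusion realized by `ι`. -/
def IrreducibleIncl (ι : A →⋆ₐ[ℂ] C) : Prop :=
  ∀ c : C, (∀ a : A, ι a * c = c * ι a) → ∃ z : ℂ, c = z • (1 : C)

variable [PartialOrder A] [StarOrderedRing A] [PartialOrder B] [StarOrderedRing B]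

/-- A conditional expectation `E^X : Y → X` with respect to `E^A` and `E^B`
(Definition 2.4 of [KT4]). -/
structure IsBimodCondExp {Y : Type*}
    [NormedAddCommGroup Y] [NormedSpace ℂ Y] [CompleteSpace Y]
    (ιA : A →⋆ₐ[ℂ] C) (ιB : B →⋆ₐ[ℂ] D)
    (EA : CondExpectation ιA) (EB : CondExpectation ιB)
    (EY : EquivBimodule C D Y) (X : Submodule ℂ Y) (EX : Y → Y) : Prop where
  map_add : ∀ y y', EX (y + y') = EX y + EX y'
  map_smul : ∀ (z : ℂ) y, EX (z • y) = z • EX y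
  mem : ∀ y, EX y ∈ X
  cond1 : ∀ (c : C), ∀ x ∈ X, EX (EY.lsmul c x) = EY.lsmul (ιA (EA.toFun c)) x
  cond2 : ∀ (a : A) (y : Y), EX (EY.lsmul (ιA a) y) = EY.lsmul (ιA a) (EX y)
  cond3 : ∀ (y : Y), ∀ x ∈ X, ιA (EA.toFun (EY.linn y x)) = EY.linn (EX y) x
  cond4 : ∀ (d : D), ∀ x ∈ X, EX (EY.rsmul x d) = EY.rsmul x (ιB (EB.toFun d))
  cond5 : ∀ (b : B) (y : Y), EX (EY.rsmul y (ιB b)) = EY.rsmul (EX y) (ιB b)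
  cond6 : ∀ (y : Y), ∀ x ∈ X, ιB (EB.toFun (EY.rinn y x)) = EY.rinn (EX y) x

/-- The C*-basic construction `C₁` for a conditional expectation `E : C → A`,
realized by a unital embedding `ιC : C →⋆ₐ[ℂ] C₁` and the Jones projection `e`. -/
structure IsBasicConstruction {A C C₁ : Type*} [CStarAlgebra A] [CStarAlgebra C]
    [CStarAlgebra C₁] [PartialOrder A] [StarOrderedRing A]
    [PartialOrder C] [StarOrderedRing C]
    (ι : A →⋆ₐ[ℂ] C) (E : CondExpectation ι)
    (ιC : C →⋆ₐ[ℂ] C₁) (e : C₁) : Prop where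
  inj : Function.Injective ιC
  idem : e * e = e
  selfadj : star e = e
  comm : ∀ a : A, ιC (ι a) * e = e * ιC (ι a)
  expect : ∀ c : C, e * ιC c * e = ιC (ι (E.toFun c)) * e
  faithful : ∀ c : C, ιC c * e = 0 → c = 0
  span : ∀ x : C₁, x ∈ Submodule.span ℂ {z : C₁ | ∃ c d : C, z = ιC c * e * ιC d}

end Unital

/-- `M` is the `A–B`-equivalence bimodule obtained by restricting the operations of the
`C–D`-equivalence bimodule `EY` to the closed subspace `X` (whose inner products on `X`
take values in the subalgebras realized by `ιA`, `ιB`). -/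
structure IsRestriction {A B C D Y : Type*}
    [NonUnitalCStarAlgebra A] [PartialOrder A] [StarOrderedRing A]
    [NonUnitalCStarAlgebra B] [PartialOrder B] [StarOrderedRing B]
    [NonUnitalCStarAlgebra C] [PartialOrder C] [StarOrderedRing C]
    [NonUnitalCStarAlgebra D] [PartialOrder D] [StarOrderedRing D]
    [NormedAddCommGroup Y] [NormedSpace ℂ Y] [CompleteSpace Y]
    (ιA : A → C) (ιB : B → D)
    (EY : EquivBimodule C D Y) (X : Submodule ℂ Y) [CompleteSpace X]
    (M : EquivBimodule A B X) : Prop where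
  lsmul_coe : ∀ (a : A) (x : X), (M.lsmul a x : Y) = EY.lsmul (ιA a) (x : Y)
  rsmul_coe : ∀ (x : X) (b : B), (M.rsmul x b : Y) = EY.rsmul (x : Y) (ιB b)
  linn_coe : ∀ x y : X, ιA (M.linn x y) = EY.linn (x : Y) (y : Y)
  rinn_coe : ∀ x y : X, ιB (M.rinn x y) = EY.rinn (x : Y) (y : Y)

section Upward

variable {A B C D C₁ D₁ : Type*} [CStarAlgebra A] [CStarAlgebra B] [CStarAlgebra C]
  [CStarAlgebra D] [CStarAlgebra C₁] [CStarAlgebra D₁]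
  [PartialOrder A] [StarOrderedRing A] [PartialOrder B] [StarOrderedRing B]
  [PartialOrder C] [StarOrderedRing C] [PartialOrder D] [StarOrderedRing D]
  [PartialOrder C₁] [StarOrderedRing C₁] [PartialOrder D₁] [StarOrderedRing D₁]

/-- A realization of the upward basic construction `C ⊗_A X ⊗_B D̃` as a
`C₁–D₁`-equivalence bimodule, where `M` is the middle `A–B`-equivalence bimodule
(`X` regarded as an `A–B`-bimodule), together with the canonical trilinear map `t`
(the map `(c, x, d) ↦ c ⊗ x ⊗ d̃`, conjugate-linear in the last variable). -/
structure IsUpwardBasic {Xc T : Type*}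
    [NormedAddCommGroup Xc] [NormedSpace ℂ Xc] [CompleteSpace Xc]
    [NormedAddCommGroup T] [NormedSpace ℂ T] [CompleteSpace T]
    (ιA : A →⋆ₐ[ℂ] C) (ιB : B →⋆ₐ[ℂ] D)
    (EA : CondExpectation ιA) (EB : CondExpectation ιB)
    (M : EquivBimodule A B Xc)
    (ιC : C →⋆ₐ[ℂ] C₁) (eA : C₁) (ιD : D →⋆ₐ[ℂ] D₁) (eB : D₁)
    (F : EquivBimodule C₁ D₁ T) (t : C → Xc → D → T) : Prop where
  add₁ : ∀ c c' x d, t (c + c') x d = t c x d + t c' x d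
  smul₁ : ∀ (z : ℂ) c x d, t (z • c) x d = z • t c x d
  add₂ : ∀ c x x' d, t c (x + x') d = t c x d + t c x' d
  smul₂ : ∀ (z : ℂ) c x d, t c (z • x) d = z • t c x d
  add₃ : ∀ c x d d', t c x (d + d') = t c x d + t c x d'
  smul₃ : ∀ (z : ℂ) c x d, t c x (z • d) = (starRingEnd ℂ z) • t c x d
  balanced₁ : ∀ (a : A) c x d, t (c * ιA a) x d = t c (M.lsmul a x) d
  balanced₂ : ∀ (b : B) c x d, t c (M.rsmul x b) d = t c x (d * ιB (star b))
  map_lsmul : ∀ c' c x d, F.lsmul (ιC c') (t c x d) = t (c' * c) x d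
  map_eA : ∀ c x d, F.lsmul eA (t c x d) = t (ιA (EA.toFun c)) x d
  map_rsmul : ∀ c x d d', F.rsmul (t c x d) (ιD d') = t c x (star d' * d)
  map_eB : ∀ c x d, F.rsmul (t c x d) eB = t c x (ιB (EB.toFun d))
  linn_eq : ∀ c c' x x' d d',
    F.linn (t c x d) (t c' x' d') =
      ιC (c * ιA (M.linn (M.rsmul x (EB.toFun (star d * d'))) x')) * eA * ιC (star c')
  rinn_eq : ∀ c c' x x' d d',
    F.rinn (t c x d) (t c' x' d') =
      ιD d * eB * ιD (ιB (M.rinn x (M.lsmul (EA.toFun (star c * c')) x')) * star d')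
  dense : Dense (Submodule.span ℂ {v : T | ∃ c x d, v = t c x d} : Set T)

end Upward




/-! ### Algebraic facts on equivalence bimodules over unital C*-algebras -/

namespace PicAux

/-- A linear subspace of a unital C*-algebra which is stable under right multiplication and has
`1` in its closure is everything. -/
theorem top_of_right_ideal {C : Type*} [CStarAlgebra C] (I : Submodule ℂ C)
    (hI : ∀ x ∈ I, ∀ c : C, x * c ∈ I) (h1 : (1 : C) ∈ closure (I : Set C)) : I = ⊤ := by
  obtain ⟨x, hx, hxI⟩ := mem_closure_iff.1 h1 {x : C | IsUnit x} Units.isOpen isUnit_one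
  obtain ⟨v, rfl⟩ := hx
  rw [Submodule.eq_top_iff']
  intro c
  have := hI _ hxI (((v⁻¹ : Cˣ) : C) * c)
  simpa using this

theorem top_of_left_ideal {C : Type*} [CStarAlgebra C] (I : Submodule ℂ C)
    (hI : ∀ x ∈ I, ∀ c : C, c * x ∈ I) (h1 : (1 : C) ∈ closure (I : Set C)) : I = ⊤ := by
  obtain ⟨x, hx, hxI⟩ := mem_closure_iff.1 h1 {x : C | IsUnit x} Units.isOpen isUnit_one
  obtain ⟨v, rfl⟩ := hx
  rw [Submodule.eq_top_iff']
  intro c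
  have := hI _ hxI (c * ((v⁻¹ : Cˣ) : C))
  simpa [mul_assoc] using this

section Basic

variable {C D Y : Type*} [CStarAlgebra C] [PartialOrder C] [StarOrderedRing C]
    [CStarAlgebra D] [PartialOrder D] [StarOrderedRing D]
    [NormedAddCommGroup Y] [NormedSpace ℂ Y] [CompleteSpace Y]
    (E : EquivBimodule C D Y)

theorem linn_add_right (x y z : Y) : E.linn x (y + z) = E.linn x y + E.linn x z := by
  rw [← E.linn_star, E.linn_add_left, star_add, E.linn_star, E.linn_star]

theorem linn_smul_right (a : ℂ) (x y : Y) :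
    E.linn x (a • y) = (starRingEnd ℂ a) • E.linn x y := by
  rw [← E.linn_star, E.linn_smul_left, star_smul, E.linn_star]; rfl

theorem rinn_add_left (x y z : Y) : E.rinn (x + y) z = E.rinn x z + E.rinn y z := by
  rw [← E.rinn_star, E.rinn_add_right, star_add, E.rinn_star, E.rinn_star]

theorem rinn_smul_left (a : ℂ) (x y : Y) :
    E.rinn (a • x) y = (starRingEnd ℂ a) • E.rinn x y := by
  rw [← E.rinn_star, E.rinn_smul_right, star_smul, E.rinn_star]; rfl

theorem linn_lsmul_right (c : C) (x y : Y) : E.linn x (E.lsmul c y) = E.linn x y * star c := by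
  rw [← E.linn_star, E.linn_lsmul_left, star_mul, E.linn_star]

theorem rinn_rsmul_left (d : D) (x y : Y) : E.rinn (E.rsmul x d) y = star d * E.rinn x y := by
  rw [← E.rinn_star, E.rinn_rsmul_right, star_mul, E.rinn_star]

theorem lsmul_sum {J : Type*} (s : Finset J) (c : C) (f : J → Y) :
    E.lsmul c (∑ i ∈ s, f i) = ∑ i ∈ s, E.lsmul c (f i) :=
  map_sum (AddMonoidHom.mk' (fun y => E.lsmul c y) (E.lsmul_add c)) f s

theorem sum_lsmul {J : Type*} (s : Finset J) (y : Y) (f : J → C) :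
    E.lsmul (∑ i ∈ s, f i) y = ∑ i ∈ s, E.lsmul (f i) y :=
  map_sum (AddMonoidHom.mk' (fun c => E.lsmul c y) (fun a b => E.add_lsmul a b y)) f s

theorem sum_rsmul {J : Type*} (s : Finset J) (d : D) (f : J → Y) :
    E.rsmul (∑ i ∈ s, f i) d = ∑ i ∈ s, E.rsmul (f i) d :=
  map_sum (AddMonoidHom.mk' (fun y => E.rsmul y d) (fun a b => E.add_rsmul a b d)) f s

theorem rsmul_sum {J : Type*} (s : Finset J) (y : Y) (f : J → D) :
    E.rsmul y (∑ i ∈ s, f i) = ∑ i ∈ s, E.rsmul y (f i) :=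
  map_sum (AddMonoidHom.mk' (fun d => E.rsmul y d) (fun a b => E.rsmul_add y a b)) f s

theorem linn_sum_left {J : Type*} (s : Finset J) (y : Y) (f : J → Y) :
    E.linn (∑ i ∈ s, f i) y = ∑ i ∈ s, E.linn (f i) y :=
  map_sum (AddMonoidHom.mk' (fun x => E.linn x y) (fun a b => E.linn_add_left a b y)) f s

theorem linn_sum_right {J : Type*} (s : Finset J) (y : Y) (f : J → Y) :
    E.linn y (∑ i ∈ s, f i) = ∑ i ∈ s, E.linn y (f i) :=
  map_sum (AddMonoidHom.mk' (fun x => E.linn y x) (fun a b => linn_add_right E y a b)) f s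

theorem rinn_sum_left {J : Type*} (s : Finset J) (y : Y) (f : J → Y) :
    E.rinn (∑ i ∈ s, f i) y = ∑ i ∈ s, E.rinn (f i) y :=
  map_sum (AddMonoidHom.mk' (fun x => E.rinn x y) (fun a b => rinn_add_left E a b y)) f s

theorem rinn_sum_right {J : Type*} (s : Finset J) (y : Y) (f : J → Y) :
    E.rinn y (∑ i ∈ s, f i) = ∑ i ∈ s, E.rinn y (f i) :=
  map_sum (AddMonoidHom.mk' (fun x => E.rinn y x) (fun a b => E.rinn_add_right y a b)) f s

theorem linn_sub_left (x y z : Y) : E.linn (x - y) z = E.linn x z - E.linn y z :=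
  map_sub (AddMonoidHom.mk' (fun x => E.linn x z) (fun a b => E.linn_add_left a b z)) x y

theorem ext_linn {x y : Y} (h : ∀ z, E.linn x z = E.linn y z) : x = y := by
  rw [← sub_eq_zero]
  apply E.linn_definite
  rw [linn_sub_left, h, sub_self]

theorem rinn_sub_right (x y z : Y) : E.rinn x (y - z) = E.rinn x y - E.rinn x z :=
  map_sub (AddMonoidHom.mk' (fun y => E.rinn x y) (fun a b => E.rinn_add_right x a b)) y z

theorem ext_rinn {x y : Y} (h : ∀ z, E.rinn z x = E.rinn z y) : x = y := by
  rw [← sub_eq_zero]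
  apply E.rinn_definite
  rw [rinn_sub_right, h, sub_self]

theorem one_lsmul (x : Y) : E.lsmul 1 x = x :=
  ext_linn E fun z => by rw [E.linn_lsmul_left, one_mul]

theorem rsmul_one (x : Y) : E.rsmul x 1 = x :=
  ext_rinn E fun z => by rw [E.rinn_rsmul_right, mul_one]

theorem span_linn_top : Submodule.span ℂ {c : C | ∃ x y, c = E.linn x y} = ⊤ := by
  apply top_of_left_ideal
  · intro x hx c
    induction hx using Submodule.span_induction with
    | mem x h =>
      obtain ⟨a, b, rfl⟩ := h
      exact Submodule.subset_span ⟨E.lsmul c a, b, (E.linn_lsmul_left _ _ _).symm⟩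
    | zero => simp
    | add x y _ _ hx hy => rw [mul_add]; exact add_mem hx hy
    | smul a x _ hx => rw [mul_smul_comm]; exact Submodule.smul_mem _ _ hx
  · exact E.full_left 1

theorem span_rinn_top : Submodule.span ℂ {c : D | ∃ x y, c = E.rinn x y} = ⊤ := by
  apply top_of_right_ideal
  · intro x hx c
    induction hx using Submodule.span_induction with
    | mem x h =>
      obtain ⟨a, b, rfl⟩ := h
      exact Submodule.subset_span ⟨a, E.rsmul b c, (E.rinn_rsmul_right _ _ _).symm⟩
    | zero => simp
    | add x y _ _ hx hy => rw [add_mul]; exact add_mem hx hy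
    | smul a x _ hx => rw [smul_mul_assoc]; exact Submodule.smul_mem _ _ hx
  · exact E.full_right 1

theorem zero_rsmul (x : Y) : E.rsmul x 0 = 0 := by
  simpa using E.smul_rsmul 0 x 0

theorem zero_lsmul (x : Y) : E.lsmul 0 x = 0 := by
  simpa using E.smul_lsmul 0 0 x

theorem lsmul_zero (c : C) : E.lsmul c 0 = 0 := by
  simpa using E.lsmul_smul 0 c 0

theorem rsmul_zero (d : D) : E.rsmul 0 d = 0 := by
  simpa using E.rsmul_smul 0 0 d

theorem linn_zero_left (x : Y) : E.linn 0 x = 0 := by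
  simpa using E.linn_smul_left 0 0 x

theorem linn_zero_right (x : Y) : E.linn x 0 = 0 := by
  simpa using linn_smul_right E 0 x 0

theorem rinn_zero_right (x : Y) : E.rinn x 0 = 0 := by
  simpa using E.rinn_smul_right 0 x 0

theorem rinn_zero_left (x : Y) : E.rinn 0 x = 0 := by
  simpa using rinn_smul_left E 0 0 x

theorem linn_rsmul (d : D) (x y : Y) :
    E.linn (E.rsmul x d) y = E.linn x (E.rsmul y (star d)) := by
  have hd : d ∈ Submodule.span ℂ {c : D | ∃ x y, c = E.rinn x y} := by
    rw [span_rinn_top]; trivial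
  induction hd using Submodule.span_induction with
  | mem d h =>
    obtain ⟨a, b, rfl⟩ := h
    rw [E.rinn_star, ← E.imprimitivity, ← E.imprimitivity, E.linn_lsmul_left,
      linn_lsmul_right, E.linn_star]
  | zero => rw [star_zero, zero_rsmul, zero_rsmul, linn_zero_left, linn_zero_right]
  | add a b _ _ ha hb => 
    rw [E.rsmul_add, E.linn_add_left, ha, hb, star_add, E.rsmul_add, linn_add_right]
  | smul a b _ hb =>
    rw [E.smul_rsmul, E.linn_smul_left, hb, star_smul, E.smul_rsmul, linn_smul_right]
    simp

theorem rinn_lsmul (c : C) (x y : Y) :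
    E.rinn (E.lsmul c x) y = E.rinn x (E.lsmul (star c) y) := by
  have hd : c ∈ Submodule.span ℂ {c : C | ∃ x y, c = E.linn x y} := by
    rw [span_linn_top]; trivial
  induction hd using Submodule.span_induction with
  | mem d h =>
    obtain ⟨a, b, rfl⟩ := h
    rw [E.linn_star, E.imprimitivity, E.imprimitivity, E.rinn_rsmul_right,
      rinn_rsmul_left, E.rinn_star]
  | zero => rw [star_zero, zero_lsmul, zero_lsmul, rinn_zero_left, rinn_zero_right]
  | add a b _ _ ha hb => 
    rw [E.add_lsmul, rinn_add_left, ha, hb, star_add, E.add_lsmul, E.rinn_add_right]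
  | smul a b _ hb =>
    rw [E.smul_lsmul, rinn_smul_left, hb, star_smul, E.smul_lsmul, E.rinn_smul_right]
    simp

/-- A right-invariant subspace whose left inner products generate the unit is everything. -/
theorem top_of_one_mem (P : Submodule ℂ Y) (hP : ∀ p ∈ P, ∀ d, E.rsmul p d ∈ P)
    (h1 : (1 : C) ∈ Submodule.span ℂ {c : C | ∃ p ∈ P, ∃ y, c = E.linn p y}) : P = ⊤ := by
  rw [Submodule.eq_top_iff']
  intro v
  have key : ∀ c ∈ Submodule.span ℂ {c : C | ∃ p ∈ P, ∃ y, c = E.linn p y},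
      E.lsmul c v ∈ P := by
    intro c hc
    induction hc using Submodule.span_induction with
    | mem d h =>
      obtain ⟨p, hp, y, rfl⟩ := h
      rw [E.imprimitivity]
      exact hP _ hp _
    | zero => rw [zero_lsmul]; exact zero_mem _
    | add a b _ _ ha hb => rw [E.add_lsmul]; exact add_mem ha hb
    | smul a b _ hb => rw [E.smul_lsmul]; exact Submodule.smul_mem _ _ hb
  simpa [one_lsmul] using key 1 h1

/-- A left-invariant subspace whose right inner products generate the unit is everything. -/
theorem top_of_one_mem' (P : Submodule ℂ Y) (hP : ∀ p ∈ P, ∀ c, E.lsmul c p ∈ P)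
    (h1 : (1 : D) ∈ Submodule.span ℂ {d : D | ∃ y, ∃ p ∈ P, d = E.rinn y p}) : P = ⊤ := by
  rw [Submodule.eq_top_iff']
  intro v
  have key : ∀ d ∈ Submodule.span ℂ {d : D | ∃ y, ∃ p ∈ P, d = E.rinn y p},
      E.rsmul v d ∈ P := by
    intro c hc
    induction hc using Submodule.span_induction with
    | mem d h =>
      obtain ⟨y, p, hp, rfl⟩ := h
      rw [← E.imprimitivity]
      exact hP _ hp _
    | zero => rw [zero_rsmul]; exact zero_mem _
    | add a b _ _ ha hb => rw [E.rsmul_add]; exact add_mem ha hb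
    | smul a b _ hb => rw [E.smul_rsmul]; exact Submodule.smul_mem _ _ hb
  simpa [rsmul_one] using key 1 h1

end Basic

/-- Two bimodules with spanning families having the same inner products are isomorphic. -/
theorem exists_iso {C D Y W I : Type*} [CStarAlgebra C] [PartialOrder C] [StarOrderedRing C]
    [CStarAlgebra D] [PartialOrder D] [StarOrderedRing D]
    [NormedAddCommGroup Y] [NormedSpace ℂ Y] [CompleteSpace Y]
    [NormedAddCommGroup W] [NormedSpace ℂ W] [CompleteSpace W]
    (E : EquivBimodule C D Y) (F : EquivBimodule C D W) (g : I → Y) (h : I → W)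
    (hg : Submodule.span ℂ (Set.range g) = ⊤) (hh : Submodule.span ℂ (Set.range h) = ⊤)
    (hl : ∀ i j, F.linn (h i) (h j) = E.linn (g i) (g j))
    (hr : ∀ i j, F.rinn (h i) (h j) = E.rinn (g i) (g j)) :
    ∃ Φ : E.Iso F, ∀ i, Φ.toEquiv (g i) = h i := by
  let L₁ := Finsupp.linearCombination ℂ g
  let L₂ := Finsupp.linearCombination ℂ h
  have s₁ : Function.Surjective L₁ := by
    rw [← LinearMap.range_eq_top, Finsupp.range_linearCombination, hg]
  have s₂ : Function.Surjective L₂ := by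
    rw [← LinearMap.range_eq_top, Finsupp.range_linearCombination, hh]
  have lin : ∀ f f', F.linn (L₂ f) (L₂ f') = E.linn (L₁ f) (L₁ f') := by
    intro f f'
    induction f using Finsupp.induction_linear with
    | zero => simp only [map_zero, linn_zero_left]
    | add a b ha hb => simp only [map_add, EquivBimodule.linn_add_left, ha, hb]
    | single i a =>
      induction f' using Finsupp.induction_linear with
      | zero => simp only [map_zero, linn_zero_right]
      | add a b ha hb => simp only [map_add, linn_add_right, ha, hb]
      | single j b =>
        simp only [L₁, L₂, Finsupp.linearCombination_single, EquivBimodule.linn_smul_left,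
          linn_smul_right, hl]
  have rin : ∀ f f', F.rinn (L₂ f) (L₂ f') = E.rinn (L₁ f) (L₁ f') := by
    intro f f'
    induction f using Finsupp.induction_linear with
    | zero => simp only [map_zero, rinn_zero_left]
    | add a b ha hb => simp only [map_add, rinn_add_left, ha, hb]
    | single i a =>
      induction f' using Finsupp.induction_linear with
      | zero => simp only [map_zero, rinn_zero_right]
      | add a b ha hb => simp only [map_add, EquivBimodule.rinn_add_right, ha, hb]
      | single j b =>
        simp only [L₁, L₂, Finsupp.linearCombination_single, EquivBimodule.rinn_smul_right,
          rinn_smul_left, hr]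
  have hker : LinearMap.ker L₁ = LinearMap.ker L₂ := by
    ext f
    simp only [LinearMap.mem_ker]
    constructor
    · intro hf
      apply F.linn_definite
      rw [lin, hf, linn_zero_left]
    · intro hf
      apply E.linn_definite
      rw [← lin, hf, linn_zero_left]
  let Ψ : Y ≃ₗ[ℂ] W := (L₁.quotKerEquivOfSurjective s₁).symm ≪≫ₗ
    Submodule.quotEquivOfEq _ _ hker ≪≫ₗ L₂.quotKerEquivOfSurjective s₂
  have hΨ : ∀ f, Ψ (L₁ f) = L₂ f := by
    intro f
    have : (L₁.quotKerEquivOfSurjective s₁).symm (L₁ f) = Submodule.Quotient.mk f := by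
      rw [LinearEquiv.symm_apply_eq]; rfl
    simp only [Ψ, LinearEquiv.trans_apply, this]
    rfl
  have hΨl : ∀ x y, F.linn (Ψ x) (Ψ y) = E.linn x y := by
    intro x y
    obtain ⟨f, rfl⟩ := s₁ x
    obtain ⟨f', rfl⟩ := s₁ y
    rw [hΨ, hΨ, lin]
  have hΨr : ∀ x y, F.rinn (Ψ x) (Ψ y) = E.rinn x y := by
    intro x y
    obtain ⟨f, rfl⟩ := s₁ x
    obtain ⟨f', rfl⟩ := s₁ y
    rw [hΨ, hΨ, rin]
  refine ⟨⟨Ψ, ?_, ?_, hΨl, hΨr⟩, ?_⟩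
  · intro c y
    refine ext_linn F fun z => ?_
    obtain ⟨z, rfl⟩ := Ψ.surjective z
    rw [hΨl, E.linn_lsmul_left, F.linn_lsmul_left, hΨl]
  · intro y d
    refine ext_rinn F fun z => ?_
    obtain ⟨z, rfl⟩ := Ψ.surjective z
    rw [hΨr, E.rinn_rsmul_right, F.rinn_rsmul_right, hΨr]
  · intro i
    have := hΨ (Finsupp.single i 1)
    simpa [L₁, L₂] using this

end PicAux


/-! ### Upward basic constructions -/

namespace PicAux

set_option linter.unusedSectionVars false

section CE

variable {A C C₁ : Type*} [CStarAlgebra A] [CStarAlgebra C] [CStarAlgebra C₁]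
    [PartialOrder A] [StarOrderedRing A] [PartialOrder C] [StarOrderedRing C]
    [PartialOrder C₁] [StarOrderedRing C₁]
    {ι : A →⋆ₐ[ℂ] C} {EA : CondExpectation ι}

theorem ce_one : EA.toFun 1 = 1 := by
  simpa using EA.retraction 1

theorem bc_one {ιC : C →⋆ₐ[ℂ] C₁} {eA : C₁} (hbc : IsBasicConstruction ι EA ιC eA)
    {n : ℕ} {u : Fin n → C} (hu : IsQuasiBasis EA u) :
    ∑ k, ιC (u k) * eA * ιC (star (u k)) = 1 := by
  have key : ∀ x : C₁, (∑ k, ιC (u k) * eA * ιC (star (u k))) * x = x := by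
    intro x
    have hx := hbc.span x
    induction hx using Submodule.span_induction with
    | mem x h =>
      obtain ⟨c, d, rfl⟩ := h
      have : ∀ k, ιC (u k) * eA * ιC (star (u k)) * (ιC c * eA * ιC d) =
          ιC (u k * ι (EA.toFun (star (u k) * c))) * (eA * ιC d) := by
        intro k
        have h1 := hbc.expect (star (u k) * c)
        rw [map_mul] at h1
        calc _ = ιC (u k) * (eA * (ιC (star (u k)) * ιC c) * eA) * ιC d := by
              simp only [mul_assoc]
          _ = _ := by rw [h1]; simp only [map_mul, mul_assoc]
      rw [Finset.sum_mul, Finset.sum_congr rfl fun k _ => this k, ← Finset.sum_mul, ← map_sum,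
        (hu c).1, mul_assoc]
    | zero => simp
    | add x y _ _ hx hy => rw [mul_add, hx, hy]
    | smul a x _ hx => rw [mul_smul_comm, hx]
  simpa using key 1

end CE

/-- The properties of `τ c y d = c ⊗ E^X(y) ⊗ d̃` used below. -/
structure Sys {A C C₁ Y T : Type*} [CStarAlgebra A] [CStarAlgebra C] [CStarAlgebra C₁]
    [PartialOrder A] [StarOrderedRing A] [PartialOrder C] [StarOrderedRing C]
    [PartialOrder C₁] [StarOrderedRing C₁]
    [NormedAddCommGroup Y] [NormedSpace ℂ Y] [CompleteSpace Y]
    [NormedAddCommGroup T] [NormedSpace ℂ T] [CompleteSpace T]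
    (ι : A →⋆ₐ[ℂ] C) (EA : CondExpectation ι) (ιC : C →⋆ₐ[ℂ] C₁) (eA : C₁)
    (EY : EquivBimodule C C Y) (X : Submodule ℂ Y) (EX : Y → Y)
    (F : EquivBimodule C₁ C₁ T) (τ : C → Y → C → T) : Prop where
  ex : IsBimodCondExp ι ι EA EA EY X EX
  xc : Submodule.span ℂ {y : Y | ∃ x ∈ X, ∃ c, y = EY.rsmul x c} = ⊤
  cx : Submodule.span ℂ {y : Y | ∃ x ∈ X, ∃ c, y = EY.lsmul c x} = ⊤
  lx : Submodule.span ℂ {c : C | ∃ y, ∃ x ∈ X, c = EY.linn x y} = ⊤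
  rx : Submodule.span ℂ {c : C | ∃ y, ∃ x ∈ X, c = EY.rinn x y} = ⊤
  one_l : (1 : C) ∈ Submodule.span ℂ {c : C | ∃ x ∈ X, ∃ y ∈ X, c = EY.linn x y}
  add₁ : ∀ c c' x d, τ (c + c') x d = τ c x d + τ c' x d
  add₂ : ∀ c x x' d, τ c (x + x') d = τ c x d + τ c x' d
  smul₂ : ∀ (z : ℂ) c x d, τ c (z • x) d = z • τ c x d
  add₃ : ∀ c x d d', τ c x (d + d') = τ c x d + τ c x d'
  ex_eq : ∀ c y d, τ c (EX y) d = τ c y d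
  bal₁ : ∀ (a : A) c y d, τ (c * ι a) y d = τ c (EY.lsmul (ι a) y) d
  bal₂ : ∀ (a : A) c y d, τ c (EY.rsmul y (ι a)) d = τ c y (d * ι (star a))
  map_lsmul : ∀ c' c x d, F.lsmul (ιC c') (τ c x d) = τ (c' * c) x d
  map_eA : ∀ c x d, F.lsmul eA (τ c x d) = τ (ι (EA.toFun c)) x d
  map_rsmul : ∀ c x d d', F.rsmul (τ c x d) (ιC d') = τ c x (star d' * d)
  map_eB : ∀ c x d, F.rsmul (τ c x d) eA = τ c x (ι (EA.toFun d))
  linn_eq : ∀ c c' x x' d d',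
    F.linn (τ c x d) (τ c' x' d') =
      ιC (c * EY.linn (EX (EY.rsmul x (ι (EA.toFun (star d * d'))))) (EX x')) * eA * ιC (star c')
  rinn_eq : ∀ c c' x x' d d',
    F.rinn (τ c x d) (τ c' x' d') =
      ιC d * eA * ιC (EY.rinn (EX x) (EX (EY.lsmul (ι (EA.toFun (star c * c'))) x')) * star d')

section Main

variable {A C C₁ Y T : Type*} [CStarAlgebra A] [CStarAlgebra C] [CStarAlgebra C₁]
    [PartialOrder A] [StarOrderedRing A] [PartialOrder C] [StarOrderedRing C]
    [PartialOrder C₁] [StarOrderedRing C₁]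
    [NormedAddCommGroup Y] [NormedSpace ℂ Y] [CompleteSpace Y]
    [NormedAddCommGroup T] [NormedSpace ℂ T] [CompleteSpace T]
    {ι : A →⋆ₐ[ℂ] C} {EA : CondExpectation ι} {ιC : C →⋆ₐ[ℂ] C₁} {eA : C₁}
    {EY : EquivBimodule C C Y} {X : Submodule ℂ Y} {EX : Y → Y}
    {F : EquivBimodule C₁ C₁ T} {τ : C → Y → C → T}

theorem ex_self (h : IsBimodCondExp ι ι EA EA EY X EX) {x : Y} (hx : x ∈ X) : EX x = x := by
  have := h.cond1 1 x hx
  rwa [ce_one, map_one, one_lsmul] at this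

theorem one_mem_linn [CompleteSpace X] {MX : EquivBimodule A A X}
    (h : IsRestriction ι ι EY X MX) :
    (1 : C) ∈ Submodule.span ℂ {c : C | ∃ x ∈ X, ∃ y ∈ X, c = EY.linn x y} := by
  have key : ∀ a ∈ Submodule.span ℂ {c : A | ∃ x y, c = MX.linn x y},
      ι a ∈ Submodule.span ℂ {c : C | ∃ x ∈ X, ∃ y ∈ X, c = EY.linn x y} := by
    intro a ha
    induction ha using Submodule.span_induction with
    | mem a ha =>
      obtain ⟨x, y, rfl⟩ := ha
      exact Submodule.subset_span ⟨x, x.2, y, y.2, h.linn_coe x y⟩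
    | zero => simp
    | add x y _ _ hx hy => rw [map_add]; exact add_mem hx hy
    | smul a x _ hx => rw [map_smul]; exact Submodule.smul_mem _ _ hx
  have := key 1 (by rw [span_linn_top]; trivial)
  rwa [map_one] at this

theorem one_mem_rinn [CompleteSpace X] {MX : EquivBimodule A A X}
    (h : IsRestriction ι ι EY X MX) :
    (1 : C) ∈ Submodule.span ℂ {c : C | ∃ x ∈ X, ∃ y ∈ X, c = EY.rinn x y} := by
  have key : ∀ a ∈ Submodule.span ℂ {c : A | ∃ x y, c = MX.rinn x y},
      ι a ∈ Submodule.span ℂ {c : C | ∃ x ∈ X, ∃ y ∈ X, c = EY.rinn x y} := by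
    intro a ha
    induction ha using Submodule.span_induction with
    | mem a ha =>
      obtain ⟨x, y, rfl⟩ := ha
      exact Submodule.subset_span ⟨x, x.2, y, y.2, h.rinn_coe x y⟩
    | zero => simp
    | add x y _ _ hx hy => rw [map_add]; exact add_mem hx hy
    | smul a x _ hx => rw [map_smul]; exact Submodule.smul_mem _ _ hx
  have := key 1 (by rw [span_rinn_top]; trivial)
  rwa [map_one] at this

theorem lx_top [CompleteSpace X] {MX : EquivBimodule A A X}
    (h : IsRestriction ι ι EY X MX) :
    Submodule.span ℂ {c : C | ∃ y, ∃ x ∈ X, c = EY.linn x y} = ⊤ := by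
  apply top_of_right_ideal
  · intro x hx c
    induction hx using Submodule.span_induction with
    | mem x h =>
      obtain ⟨y, a, ha, rfl⟩ := h
      refine Submodule.subset_span ⟨EY.lsmul (star c) y, a, ha, ?_⟩
      rw [linn_lsmul_right, star_star]
    | zero => simp
    | add x y _ _ hx hy => rw [add_mul]; exact add_mem hx hy
    | smul a x _ hx => rw [smul_mul_assoc]; exact Submodule.smul_mem _ _ hx
  · refine subset_closure (Submodule.span_mono ?_ (one_mem_linn h))
    rintro _ ⟨x, hx, y, hy, rfl⟩
    exact ⟨y, x, hx, rfl⟩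

theorem rx_top' [CompleteSpace X] {MX : EquivBimodule A A X}
    (h : IsRestriction ι ι EY X MX) :
    Submodule.span ℂ {c : C | ∃ y, ∃ x ∈ X, c = EY.rinn y x} = ⊤ := by
  apply top_of_left_ideal
  · intro x hx c
    induction hx using Submodule.span_induction with
    | mem x h =>
      obtain ⟨y, a, ha, rfl⟩ := h
      refine Submodule.subset_span ⟨EY.rsmul y (star c), a, ha, ?_⟩
      rw [rinn_rsmul_left, star_star]
    | zero => simp
    | add x y _ _ hx hy => rw [mul_add]; exact add_mem hx hy
    | smul a x _ hx => rw [mul_smul_comm]; exact Submodule.smul_mem _ _ hx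
  · refine subset_closure (Submodule.span_mono ?_ (one_mem_rinn h))
    rintro _ ⟨x, hx, y, hy, rfl⟩
    exact ⟨x, y, hy, rfl⟩

theorem rx_top [CompleteSpace X] {MX : EquivBimodule A A X}
    (h : IsRestriction ι ι EY X MX) :
    Submodule.span ℂ {c : C | ∃ y, ∃ x ∈ X, c = EY.rinn x y} = ⊤ := by
  apply top_of_right_ideal
  · intro x hx c
    induction hx using Submodule.span_induction with
    | mem x h =>
      obtain ⟨y, a, ha, rfl⟩ := h
      refine Submodule.subset_span ⟨EY.rsmul y c, a, ha, ?_⟩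
      rw [EY.rinn_rsmul_right]
    | zero => simp
    | add x y _ _ hx hy => rw [add_mul]; exact add_mem hx hy
    | smul a x _ hx => rw [smul_mul_assoc]; exact Submodule.smul_mem _ _ hx
  · refine subset_closure (Submodule.span_mono ?_ (one_mem_rinn h))
    rintro _ ⟨x, hx, y, hy, rfl⟩
    exact ⟨y, x, hx, rfl⟩

theorem xc_top [CompleteSpace X] {MX : EquivBimodule A A X}
    (h : IsRestriction ι ι EY X MX) :
    Submodule.span ℂ {y : Y | ∃ x ∈ X, ∃ c, y = EY.rsmul x c} = ⊤ := by
  apply top_of_one_mem EY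
  · intro p hp d
    induction hp using Submodule.span_induction with
    | mem x h =>
      obtain ⟨y, hy, c, rfl⟩ := h
      exact Submodule.subset_span ⟨y, hy, c * d, (EY.rsmul_mul _ _ _).symm⟩
    | zero => rw [rsmul_zero]; exact zero_mem _
    | add x y _ _ hx hy => rw [EY.add_rsmul]; exact add_mem hx hy
    | smul a x _ hx => rw [EY.rsmul_smul]; exact Submodule.smul_mem _ _ hx
  · have : (1 : C) ∈ Submodule.span ℂ {c : C | ∃ y, ∃ x ∈ X, c = EY.linn x y} := by
      rw [lx_top h]; trivial
    refine Submodule.span_mono ?_ this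
    rintro _ ⟨y, x, hx, rfl⟩
    exact ⟨x, Submodule.subset_span ⟨x, hx, 1, (rsmul_one EY x).symm⟩, y, rfl⟩

theorem cx_top [CompleteSpace X] {MX : EquivBimodule A A X}
    (h : IsRestriction ι ι EY X MX) :
    Submodule.span ℂ {y : Y | ∃ x ∈ X, ∃ c, y = EY.lsmul c x} = ⊤ := by
  apply top_of_one_mem' EY
  · intro p hp d
    induction hp using Submodule.span_induction with
    | mem x h =>
      obtain ⟨y, hy, c, rfl⟩ := h
      exact Submodule.subset_span ⟨y, hy, d * c, (EY.mul_lsmul _ _ _).symm⟩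
    | zero => rw [lsmul_zero]; exact zero_mem _
    | add x y _ _ hx hy => rw [EY.lsmul_add]; exact add_mem hx hy
    | smul a x _ hx => rw [EY.lsmul_smul]; exact Submodule.smul_mem _ _ hx
  · have : (1 : C) ∈ Submodule.span ℂ {c : C | ∃ y, ∃ x ∈ X, c = EY.rinn y x} := by
      rw [rx_top' h]; trivial
    refine Submodule.span_mono ?_ this
    rintro _ ⟨y, x, hx, rfl⟩
    exact ⟨y, x, Submodule.subset_span ⟨x, hx, 1, (one_lsmul EY x).symm⟩, rfl⟩

theorem mkSys [CompleteSpace X] (MX : EquivBimodule A A X)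
    (hM : IsRestriction ι ι EY X MX) (hEX : IsBimodCondExp ι ι EA EA EY X EX)
    (t : C → X → C → T) (ht : IsUpwardBasic ι ι EA EA MX ιC eA ιC eA F t) :
    Sys ι EA ιC eA EY X EX F (fun c y d => t c ⟨EX y, hEX.mem y⟩ d) where
  ex := hEX
  xc := xc_top hM
  cx := cx_top hM
  lx := lx_top hM
  rx := rx_top hM
  one_l := one_mem_linn hM
  add₁ := fun c c' x d => ht.add₁ _ _ _ _
  add₂ := fun c x x' d => by
    rw [← ht.add₂]; congr 1; exact Subtype.ext (hEX.map_add _ _)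
  smul₂ := fun z c x d => by
    rw [← ht.smul₂]; congr 1; exact Subtype.ext (hEX.map_smul _ _)
  add₃ := fun c x d d' => ht.add₃ _ _ _ _
  ex_eq := fun c y d => by
    congr 1; exact Subtype.ext (ex_self hEX (hEX.mem y))
  bal₁ := fun a c y d => by
    rw [ht.balanced₁]; congr 1
    apply Subtype.ext
    rw [hM.lsmul_coe]
    exact (hEX.cond2 _ _).symm
  bal₂ := fun a c y d => by
    rw [← ht.balanced₂]; congr 1
    apply Subtype.ext
    rw [hM.rsmul_coe]
    exact hEX.cond5 _ _
  map_lsmul := fun c' c x d => ht.map_lsmul _ _ _ _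
  map_eA := fun c x d => ht.map_eA _ _ _
  map_rsmul := fun c x d d' => ht.map_rsmul _ _ _ _
  map_eB := fun c x d => ht.map_eB _ _ _
  linn_eq := fun c c' x x' d d' => by
    rw [ht.linn_eq, hM.linn_coe, hM.rsmul_coe, hEX.cond5]
  rinn_eq := fun c c' x x' d d' => by
    rw [ht.rinn_eq, hM.rinn_coe, hM.lsmul_coe, hEX.cond2]

namespace Sys


theorem sum₁ (S : Sys ι EA ιC eA EY X EX F τ) {J : Type*} (s : Finset J) (f : J → C) (y : Y) (d : C) :
    τ (∑ i ∈ s, f i) y d = ∑ i ∈ s, τ (f i) y d :=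
  map_sum (AddMonoidHom.mk' (fun c => τ c y d) (fun a b => S.add₁ a b y d)) f s

theorem sum₂ (S : Sys ι EA ιC eA EY X EX F τ) {J : Type*} (s : Finset J) (f : J → Y) (c : C) (d : C) :
    τ c (∑ i ∈ s, f i) d = ∑ i ∈ s, τ c (f i) d :=
  map_sum (AddMonoidHom.mk' (fun y => τ c y d) (fun a b => S.add₂ c a b d)) f s

theorem sum₃ (S : Sys ι EA ιC eA EY X EX F τ) {J : Type*} (s : Finset J) (f : J → C) (c : C) (y : Y) :
    τ c y (∑ i ∈ s, f i) = ∑ i ∈ s, τ c y (f i) :=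
  map_sum (AddMonoidHom.mk' (fun d => τ c y d) (fun a b => S.add₃ c y a b)) f s

theorem ex_sum (S : Sys ι EA ιC eA EY X EX F τ) {J : Type*} (s : Finset J) (f : J → Y) :
    EX (∑ i ∈ s, f i) = ∑ i ∈ s, EX (f i) :=
  map_sum (AddMonoidHom.mk' EX S.ex.map_add) f s

theorem linn_ex (S : Sys ι EA ιC eA EY X EX F τ) {x : Y} (hx : x ∈ X) (y : Y) :
    EY.linn x (EX y) = ι (EA.toFun (EY.linn x y)) := by
  rw [← EY.linn_star, ← S.ex.cond3 y x hx, ← map_star, ← EA.map_star, EY.linn_star]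

theorem rinn_ex (S : Sys ι EA ιC eA EY X EX F τ) {x : Y} (hx : x ∈ X) (y : Y) :
    EY.rinn x (EX y) = ι (EA.toFun (EY.rinn x y)) := by
  rw [← EY.rinn_star, ← S.ex.cond6 y x hx, ← map_star, ← EA.map_star, EY.rinn_star]

theorem ex_zero (S : Sys ι EA ιC eA EY X EX F τ) : EX 0 = 0 := by
  simpa using S.ex.map_smul 0 0

theorem rec_r (S : Sys ι EA ιC eA EY X EX F τ) {n : ℕ} {u : Fin n → C} (hu : IsQuasiBasis EA u)
    (y : Y) : ∑ l, EY.rsmul (EX (EY.rsmul y (u l))) (star (u l)) = y := by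
  have hy : y ∈ Submodule.span ℂ {y : Y | ∃ x ∈ X, ∃ c, y = EY.rsmul x c} := by
    rw [S.xc]; trivial
  induction hy using Submodule.span_induction with
  | mem y h =>
    obtain ⟨x, hx, c, rfl⟩ := h
    simp only [← EY.rsmul_mul, S.ex.cond4 _ x hx]
    rw [← rsmul_sum, (hu c).2]
  | zero => simp only [rsmul_zero, S.ex_zero, Finset.sum_const_zero]
  | add a b _ _ ha hb => 
    simp only [EY.add_rsmul, S.ex.map_add, Finset.sum_add_distrib, ha, hb]
  | smul a b _ hb =>
    simp only [EY.rsmul_smul, S.ex.map_smul, ← Finset.smul_sum, hb]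

theorem rec_l (S : Sys ι EA ιC eA EY X EX F τ) {n : ℕ} {u : Fin n → C} (hu : IsQuasiBasis EA u)
    (y : Y) : ∑ l, EY.lsmul (u l) (EX (EY.lsmul (star (u l)) y)) = y := by
  have hy : y ∈ Submodule.span ℂ {y : Y | ∃ x ∈ X, ∃ c, y = EY.lsmul c x} := by
    rw [S.cx]; trivial
  induction hy using Submodule.span_induction with
  | mem y h =>
    obtain ⟨x, hx, c, rfl⟩ := h
    simp only [← EY.mul_lsmul, S.ex.cond1 _ x hx]
    rw [← sum_lsmul, (hu c).1]
  | zero => simp only [lsmul_zero, S.ex_zero, Finset.sum_const_zero]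
  | add a b _ _ ha hb => 
    simp only [EY.lsmul_add, S.ex.map_add, Finset.sum_add_distrib, ha, hb]
  | smul a b _ hb =>
    simp only [EY.lsmul_smul, S.ex.map_smul, ← Finset.smul_sum, hb]

/-- The canonical map `φ_Y`. -/
def phi {n : ℕ} (u : Fin n → C) (EY : EquivBimodule C C Y) (τ : C → Y → C → T) (y : Y) : T :=
  ∑ i, ∑ j, τ (u i) (EY.lsmul (star (u i)) (EY.rsmul y (u j))) (u j)

theorem linn_tau_phi (S : Sys ι EA ιC eA EY X EX F τ) {n : ℕ} {u : Fin n → C}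
    (hu : IsQuasiBasis EA u) (hbc : IsBasicConstruction ι EA ιC eA) (c d : C) (y z : Y) :
    F.linn (τ c y d) (phi u EY τ z) =
      ιC c * eA * ιC (EY.linn (EX y) (EY.rsmul z d)) := by
  have h1 : ∀ k, ∑ l, EY.linn (EX (EY.rsmul y (ι (EA.toFun (star d * u l)))))
      (EX (EY.lsmul (star (u k)) (EY.rsmul z (u l)))) =
      ι (EA.toFun (EY.linn (EX y) (EY.rsmul z d) * u k)) := by
    intro k
    simp only [S.ex.cond5, linn_rsmul, ← map_star, ← EA.map_star, star_mul, star_star]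
    simp only [← S.ex.cond5, ← linn_sum_right, ← S.ex_sum, EY.lsmul_rsmul, ← EY.rsmul_mul,
      ← lsmul_sum, ← rsmul_sum, (hu d).1]
    rw [S.linn_ex (S.ex.mem y), linn_lsmul_right, star_star]
  set w := EY.linn (EX y) (EY.rsmul z d)
  calc F.linn (τ c y d) (phi u EY τ z)
      = ∑ k, ιC (c * ∑ l, EY.linn (EX (EY.rsmul y (ι (EA.toFun (star d * u l)))))
          (EX (EY.lsmul (star (u k)) (EY.rsmul z (u l))))) * eA * ιC (star (u k)) := by
        simp only [phi, linn_sum_right, S.linn_eq, Finset.mul_sum, Finset.sum_mul, map_sum]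
    _ = ∑ k, ιC c * eA * ιC w * (ιC (u k) * eA * ιC (star (u k))) := by
        refine Finset.sum_congr rfl fun k _ => ?_
        rw [h1, map_mul, mul_assoc (ιC c), ← hbc.expect, map_mul]
        simp only [mul_assoc]
    _ = _ := by
        rw [← Finset.mul_sum, bc_one hbc hu, mul_one]

theorem rinn_tau_phi (S : Sys ι EA ιC eA EY X EX F τ) {n : ℕ} {u : Fin n → C}
    (hu : IsQuasiBasis EA u) (c d : C) (y z : Y) :
    F.rinn (τ c y d) (phi u EY τ z) =
      ιC d * eA * ιC (EY.rinn (EX y) (EY.lsmul (star c) z)) := by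
  have h1 : ∀ l, ∑ k, EY.rinn (EX y) (EX (EY.lsmul (ι (EA.toFun (star c * u k)))
      (EY.lsmul (star (u k)) (EY.rsmul z (u l))))) =
      ι (EA.toFun (EY.rinn (EX y) (EY.lsmul (star c) z) * u l)) := by
    intro k
    simp only [← rinn_sum_right, ← S.ex_sum, ← EY.mul_lsmul, ← sum_lsmul, (hu (star c)).2]
    rw [S.rinn_ex (S.ex.mem y), ← EY.lsmul_rsmul, EY.rinn_rsmul_right]
  set w := EY.rinn (EX y) (EY.lsmul (star c) z)
  calc F.rinn (τ c y d) (phi u EY τ z)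
      = ∑ l, ιC d * eA * ιC ((∑ k, EY.rinn (EX y) (EX (EY.lsmul (ι (EA.toFun (star c * u k)))
      (EY.lsmul (star (u k)) (EY.rsmul z (u l)))))) * star (u l)) := by
        rw [phi, Finset.sum_comm]
        simp only [rinn_sum_right, S.rinn_eq, Finset.mul_sum, Finset.sum_mul, map_sum]
    _ = _ := by
        simp only [h1]
        rw [← Finset.mul_sum, ← map_sum, (hu w).2]

theorem linn_phi_phi (S : Sys ι EA ιC eA EY X EX F τ) {n : ℕ} {u : Fin n → C}
    (hu : IsQuasiBasis EA u) (hbc : IsBasicConstruction ι EA ιC eA) (y z : Y) :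
    F.linn (phi u EY τ y) (phi u EY τ z) = ιC (EY.linn y z) := by
  have h1 : ∀ i, ∑ j, EY.linn (EX (EY.lsmul (star (u i)) (EY.rsmul y (u j))))
      (EY.rsmul z (u j)) = star (u i) * EY.linn y z := by
    intro i
    rw [← EY.linn_lsmul_left]
    conv_rhs => rw [← S.rec_r hu (EY.lsmul (star (u i)) y)]
    simp only [linn_sum_left, linn_rsmul, star_star, EY.lsmul_rsmul]
  conv_lhs => arg 2; rw [phi]
  simp only [linn_sum_left, S.linn_tau_phi hu hbc, ← Finset.mul_sum, ← map_sum, h1]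
  simp only [map_mul, ← mul_assoc]
  rw [← Finset.sum_mul, bc_one hbc hu, one_mul]

theorem rinn_phi_phi (S : Sys ι EA ιC eA EY X EX F τ) {n : ℕ} {u : Fin n → C}
    (hu : IsQuasiBasis EA u) (hbc : IsBasicConstruction ι EA ιC eA) (y z : Y) :
    F.rinn (phi u EY τ y) (phi u EY τ z) = ιC (EY.rinn y z) := by
  have h1 : ∀ j, ∑ i, EY.rinn (EX (EY.lsmul (star (u i)) (EY.rsmul y (u j))))
      (EY.lsmul (star (u i)) z) = star (u j) * EY.rinn y z := by
    intro i
    rw [← rinn_rsmul_left]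
    conv_rhs => rw [← S.rec_l hu (EY.rsmul y (u i))]
    simp only [rinn_sum_left, rinn_lsmul]
  conv_lhs => arg 2; rw [phi, Finset.sum_comm]
  simp only [rinn_sum_left, S.rinn_tau_phi hu, ← Finset.mul_sum, ← map_sum, h1]
  simp only [map_mul, ← mul_assoc]
  rw [← Finset.sum_mul, bc_one hbc hu, one_mul]

theorem phi_add (S : Sys ι EA ιC eA EY X EX F τ) {n : ℕ} (u : Fin n → C) (y z : Y) :
    phi u EY τ (y + z) = phi u EY τ y + phi u EY τ z := by
  simp only [phi, EY.add_rsmul, EY.lsmul_add, S.add₂, Finset.sum_add_distrib]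

theorem phi_smul (S : Sys ι EA ιC eA EY X EX F τ) {n : ℕ} (u : Fin n → C) (a : ℂ) (y : Y) :
    phi u EY τ (a • y) = a • phi u EY τ y := by
  simp only [phi, EY.rsmul_smul, EY.lsmul_smul, S.smul₂, Finset.smul_sum]

/-- `φ_Y` as a linear map. -/
def phiL (S : Sys ι EA ιC eA EY X EX F τ) {n : ℕ} (u : Fin n → C) : Y →ₗ[ℂ] T where
  toFun := phi u EY τ
  map_add' := S.phi_add u
  map_smul' := S.phi_smul u

theorem norm_phi (S : Sys ι EA ιC eA EY X EX F τ) {n : ℕ} {u : Fin n → C}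
    (hu : IsQuasiBasis EA u) (hbc : IsBasicConstruction ι EA ιC eA) (y : Y) :
    ‖phi u EY τ y‖ = ‖y‖ := by
  have : ‖phi u EY τ y‖ ^ 2 = ‖y‖ ^ 2 := by
    rw [← F.norm_linn, S.linn_phi_phi hu hbc, NonUnitalStarAlgHom.norm_map ιC hbc.inj,
      EY.norm_linn]
  exact (sq_eq_sq₀ (norm_nonneg _) (norm_nonneg _)).1 this

theorem closed_range (S : Sys ι EA ιC eA EY X EX F τ) {n : ℕ} {u : Fin n → C}
    (hu : IsQuasiBasis EA u) (hbc : IsBasicConstruction ι EA ιC eA) :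
    IsClosed ((LinearMap.range (S.phiL u) : Submodule ℂ T) : Set T) := by
  have : Isometry (S.phiL u) :=
    AddMonoidHomClass.isometry_of_norm _ (S.norm_phi hu hbc)
  rw [LinearMap.coe_range]
  exact this.isClosedEmbedding.isClosed_range

theorem closure_eq (S : Sys ι EA ιC eA EY X EX F τ) {n : ℕ} {u : Fin n → C}
    (hu : IsQuasiBasis EA u) (hbc : IsBasicConstruction ι EA ιC eA) :
    (Submodule.span ℂ (Set.range fun y : Y => phi u EY τ y)).topologicalClosure =
      LinearMap.range (S.phiL u) := by
  have h : Submodule.span ℂ (Set.range fun y : Y => phi u EY τ y) =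
      LinearMap.range (S.phiL u) := by
    have : (Set.range fun y : Y => phi u EY τ y) = (LinearMap.range (S.phiL u) : Set T) := rfl
    rw [this, Submodule.span_eq]
  rw [h]
  exact (S.closed_range hu hbc).submodule_topologicalClosure_eq

theorem span_tau_top (S : Sys ι EA ιC eA EY X EX F τ) {n : ℕ} {u : Fin n → C}
    (hu : IsQuasiBasis EA u) (hbc : IsBasicConstruction ι EA ιC eA) (Q : Set Y)
    (hQ : ∀ x ∈ Q, x ∈ X)
    (h1 : (1 : C) ∈ Submodule.span ℂ {c : C | ∃ x ∈ Q, ∃ y ∈ Q, c = EY.linn x y}) :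
    Submodule.span ℂ {v : T | ∃ c d, ∃ x ∈ Q, v = τ c x d} = ⊤ := by
  apply top_of_one_mem F
  · intro p hp g
    induction hp using Submodule.span_induction with
    | mem p h =>
      obtain ⟨c, d, x, hx, rfl⟩ := h
      have hg := hbc.span g
      induction hg using Submodule.span_induction with
      | mem g h =>
        obtain ⟨c', d', rfl⟩ := h
        rw [F.rsmul_mul, F.rsmul_mul, S.map_rsmul, S.map_eB, S.map_rsmul]
        exact Submodule.subset_span ⟨_, _, x, hx, rfl⟩
      | zero => rw [zero_rsmul]; exact zero_mem _
      | add a b _ _ ha hb => rw [F.rsmul_add]; exact add_mem ha hb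
      | smul a b _ hb => rw [F.smul_rsmul]; exact Submodule.smul_mem _ _ hb
    | zero => rw [rsmul_zero]; exact zero_mem _
    | add a b _ _ ha hb => rw [F.add_rsmul]; exact add_mem ha hb
    | smul a b _ hb => rw [F.rsmul_smul]; exact Submodule.smul_mem _ _ hb
  · have key : ∀ a ∈ Submodule.span ℂ {c : C | ∃ x ∈ Q, ∃ y ∈ Q, c = EY.linn x y},
        ∑ k, ιC (u k * a) * eA * ιC (star (u k)) ∈ Submodule.span ℂ {c : C₁ | ∃ p ∈
          Submodule.span ℂ {v : T | ∃ c d, ∃ x ∈ Q, v = τ c x d}, ∃ y, c = F.linn p y} := by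
      intro a ha
      induction ha using Submodule.span_induction with
      | mem a h =>
        obtain ⟨x, hx, y, hy, rfl⟩ := h
        refine Submodule.sum_mem _ fun k _ => Submodule.subset_span
          ⟨τ (u k) x 1, Submodule.subset_span ⟨_, _, x, hx, rfl⟩, τ (u k) y 1, ?_⟩
        rw [S.linn_eq, star_one, one_mul, ce_one, map_one, rsmul_one,
          ex_self S.ex (hQ _ hx), ex_self S.ex (hQ _ hy)]
      | zero => simp
      | add a b _ _ ha hb =>
        simp only [mul_add, map_add, add_mul, Finset.sum_add_distrib]
        exact add_mem ha hb
      | smul a b _ hb =>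
        simp only [mul_smul_comm, map_smul, smul_mul_assoc, ← Finset.smul_sum]
        exact Submodule.smul_mem _ _ hb
    have := key 1 h1
    simpa only [mul_one, bc_one hbc hu] using this

theorem tau_top (S : Sys ι EA ιC eA EY X EX F τ) {n : ℕ} {u : Fin n → C}
    (hu : IsQuasiBasis EA u) (hbc : IsBasicConstruction ι EA ιC eA) :
    Submodule.span ℂ {v : T | ∃ c d, ∃ x ∈ X, v = τ c x d} = ⊤ :=
  S.span_tau_top hu hbc X (fun _ h => h) S.one_l

theorem ext_tau (S : Sys ι EA ιC eA EY X EX F τ) {n : ℕ} {u : Fin n → C}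
    (hu : IsQuasiBasis EA u) (hbc : IsBasicConstruction ι EA ιC eA) {v w : T}
    (h : ∀ c y d, F.linn (τ c y d) v = F.linn (τ c y d) w) : v = w := by
  refine ext_linn F fun z => ?_
  rw [← F.linn_star z, ← F.linn_star z]
  congr 1
  have hz : z ∈ Submodule.span ℂ {v : T | ∃ c d, ∃ x ∈ X, v = τ c x d} := by
    rw [S.tau_top hu hbc]; trivial
  induction hz using Submodule.span_induction with
  | mem z hz => obtain ⟨c, d, x, _, rfl⟩ := hz; exact h c x d
  | zero => rw [linn_zero_left, linn_zero_left]
  | add a b _ _ ha hb => rw [F.linn_add_left, ha, hb, F.linn_add_left]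
  | smul a b _ hb => rw [F.linn_smul_left, hb, F.linn_smul_left]

theorem ext_tau' (S : Sys ι EA ιC eA EY X EX F τ) {n : ℕ} {u : Fin n → C}
    (hu : IsQuasiBasis EA u) (hbc : IsBasicConstruction ι EA ιC eA) {v w : T}
    (h : ∀ c y d, F.rinn (τ c y d) v = F.rinn (τ c y d) w) : v = w := by
  refine ext_rinn F fun z => ?_
  have hz : z ∈ Submodule.span ℂ {v : T | ∃ c d, ∃ x ∈ X, v = τ c x d} := by
    rw [S.tau_top hu hbc]; trivial
  induction hz using Submodule.span_induction with
  | mem z hz => obtain ⟨c, d, x, _, rfl⟩ := hz; exact h c x d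
  | zero => rw [rinn_zero_left, rinn_zero_left]
  | add a b _ _ ha hb => rw [rinn_add_left, ha, hb, rinn_add_left]
  | smul a b _ hb => rw [rinn_smul_left, hb, rinn_smul_left]

theorem phi_lsmul (S : Sys ι EA ιC eA EY X EX F τ) {n : ℕ} {u : Fin n → C}
    (hu : IsQuasiBasis EA u) (hbc : IsBasicConstruction ι EA ιC eA) (c : C) (y : Y) :
    F.lsmul (ιC c) (phi u EY τ y) = phi u EY τ (EY.lsmul c y) := by
  refine S.ext_tau hu hbc fun c' y' d => ?_
  rw [linn_lsmul_right, S.linn_tau_phi hu hbc, S.linn_tau_phi hu hbc, EY.lsmul_rsmul,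
    linn_lsmul_right, ← map_star, mul_assoc, ← map_mul]

theorem phi_rsmul (S : Sys ι EA ιC eA EY X EX F τ) {n : ℕ} {u : Fin n → C}
    (hu : IsQuasiBasis EA u) (hbc : IsBasicConstruction ι EA ιC eA) (c : C) (y : Y) :
    F.rsmul (phi u EY τ y) (ιC c) = phi u EY τ (EY.rsmul y c) := by
  refine S.ext_tau' hu hbc fun c' y' d => ?_
  rw [F.rinn_rsmul_right, S.rinn_tau_phi hu, S.rinn_tau_phi hu, ← EY.lsmul_rsmul,
    EY.rinn_rsmul_right, mul_assoc, ← map_mul]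

/-- Part (a). -/
theorem isEquiPair (S : Sys ι EA ιC eA EY X EX F τ) {n : ℕ} {u : Fin n → C}
    (hu : IsQuasiBasis EA u) (hbc : IsBasicConstruction ι EA ιC eA) :
    IsEquiPair ιC F (LinearMap.range (S.phiL u)) := by
  have hphi : ∀ y, S.phiL u y = phi u EY τ y := fun _ => rfl
  have hcl : IsClosed (Set.range ιC) :=
    (NonUnitalStarAlgHom.isometry ιC hbc.inj).isClosedEmbedding.isClosed_range
  refine ⟨S.closed_range hu hbc, ?_, ?_, ?_, ?_, ?_, ?_, ?_, ?_⟩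
  · rintro c _ ⟨y, rfl⟩
    exact ⟨_, (S.phi_lsmul hu hbc c y).symm⟩
  · rintro c _ ⟨y, rfl⟩
    exact ⟨_, (S.phi_rsmul hu hbc c y).symm⟩
  · rintro _ ⟨y, rfl⟩ _ ⟨z, rfl⟩
    exact ⟨_, (S.linn_phi_phi hu hbc y z).symm⟩
  · rintro _ ⟨y, rfl⟩ _ ⟨z, rfl⟩
    exact ⟨_, (S.rinn_phi_phi hu hbc y z).symm⟩
  · have : (Submodule.span ℂ {c : C₁ | ∃ x ∈ LinearMap.range (S.phiL u),
        ∃ y ∈ LinearMap.range (S.phiL u), c = F.linn x y}) =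
        (Submodule.span ℂ {c : C | ∃ x y, c = EY.linn x y}).map (ιC : C →ₗ[ℂ] C₁) := by
      rw [Submodule.map_span]
      congr 1
      ext c
      constructor
      · rintro ⟨_, ⟨y, rfl⟩, _, ⟨z, rfl⟩, rfl⟩
        exact ⟨_, ⟨y, z, rfl⟩, (S.linn_phi_phi hu hbc y z).symm⟩
      · rintro ⟨_, ⟨y, z, rfl⟩, rfl⟩
        exact ⟨_, ⟨y, rfl⟩, _, ⟨z, rfl⟩, (S.linn_phi_phi hu hbc y z).symm⟩
    rw [this, span_linn_top, Submodule.map_top, LinearMap.coe_range]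
    exact hcl.closure_eq
  · have : (Submodule.span ℂ {c : C₁ | ∃ y, ∃ x ∈ LinearMap.range (S.phiL u),
        c = F.linn y x}) = ⊤ := by
      rw [Submodule.eq_top_iff']
      intro g
      refine Submodule.span_le.2 ?_ (hbc.span g)
      rintro _ ⟨c, d, rfl⟩
      have hd : d ∈ Submodule.span ℂ {c : C | ∃ y, ∃ x ∈ X, c = EY.linn x y} := by
        rw [S.lx]; trivial
      induction hd using Submodule.span_induction with
      | mem d h =>
        obtain ⟨y, x, hx, rfl⟩ := h
        refine Submodule.subset_span ⟨τ c x 1, phi u EY τ y, ⟨y, rfl⟩, ?_⟩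
        rw [S.linn_tau_phi hu hbc, rsmul_one, ex_self S.ex hx]
      | zero => simp
      | add a b _ _ ha hb => rw [map_add, mul_add]; exact add_mem ha hb
      | smul a b _ hb => rw [map_smul, mul_smul_comm]; exact Submodule.smul_mem _ _ hb
    rw [this]
    exact dense_univ
  · have : (Submodule.span ℂ {c : C₁ | ∃ x ∈ LinearMap.range (S.phiL u),
        ∃ y ∈ LinearMap.range (S.phiL u), c = F.rinn x y}) =
        (Submodule.span ℂ {c : C | ∃ x y, c = EY.rinn x y}).map (ιC : C →ₗ[ℂ] C₁) := by
      rw [Submodule.map_span]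
      congr 1
      ext c
      constructor
      · rintro ⟨_, ⟨y, rfl⟩, _, ⟨z, rfl⟩, rfl⟩
        exact ⟨_, ⟨y, z, rfl⟩, (S.rinn_phi_phi hu hbc y z).symm⟩
      · rintro ⟨_, ⟨y, z, rfl⟩, rfl⟩
        exact ⟨_, ⟨y, rfl⟩, _, ⟨z, rfl⟩, (S.rinn_phi_phi hu hbc y z).symm⟩
    rw [this, span_rinn_top, Submodule.map_top, LinearMap.coe_range]
    exact hcl.closure_eq
  · have : (Submodule.span ℂ {c : C₁ | ∃ y, ∃ x ∈ LinearMap.range (S.phiL u),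
        c = F.rinn y x}) = ⊤ := by
      rw [Submodule.eq_top_iff']
      intro g
      refine Submodule.span_le.2 ?_ (hbc.span g)
      rintro _ ⟨c, d, rfl⟩
      have hd : d ∈ Submodule.span ℂ {c : C | ∃ y, ∃ x ∈ X, c = EY.rinn x y} := by
        rw [S.rx]; trivial
      induction hd using Submodule.span_induction with
      | mem d h =>
        obtain ⟨y, x, hx, rfl⟩ := h
        refine Submodule.subset_span ⟨τ 1 x c, phi u EY τ y, ⟨y, rfl⟩, ?_⟩
        rw [S.rinn_tau_phi hu, star_one, one_lsmul, ex_self S.ex hx]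
      | zero => simp
      | add a b _ _ ha hb => rw [map_add, mul_add]; exact add_mem ha hb
      | smul a b _ hb => rw [map_smul, mul_smul_comm]; exact Submodule.smul_mem _ _ hb
    rw [this]
    exact dense_univ

end Sys

end Main

open Sys (phi)

section PartB

variable {A C C₁ Y T Y' T' : Type*} [CStarAlgebra A] [CStarAlgebra C] [CStarAlgebra C₁]
    [PartialOrder A] [StarOrderedRing A] [PartialOrder C] [StarOrderedRing C]
    [PartialOrder C₁] [StarOrderedRing C₁]
    [NormedAddCommGroup Y] [NormedSpace ℂ Y] [CompleteSpace Y]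
    [NormedAddCommGroup T] [NormedSpace ℂ T] [CompleteSpace T]
    [NormedAddCommGroup Y'] [NormedSpace ℂ Y'] [CompleteSpace Y']
    [NormedAddCommGroup T'] [NormedSpace ℂ T'] [CompleteSpace T']
    {ι : A →⋆ₐ[ℂ] C} {EA : CondExpectation ι} {ιC : C →⋆ₐ[ℂ] C₁} {eA : C₁}
    {EY : EquivBimodule C C Y} {X : Submodule ℂ Y} {EX : Y → Y}
    {F : EquivBimodule C₁ C₁ T} {τ : C → Y → C → T}
    {EY' : EquivBimodule C C Y'} {X' : Submodule ℂ Y'} {EX' : Y' → Y'}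
    {F' : EquivBimodule C₁ C₁ T'} {τ' : C → Y' → C → T'}

/-- Part (b). -/
theorem partB (S : Sys ι EA ιC eA EY X EX F τ) (S' : Sys ι EA ιC eA EY' X' EX' F' τ')
    {n : ℕ} {u : Fin n → C}
    (hu : IsQuasiBasis EA u) (hbc : IsBasicConstruction ι EA ιC eA)
    (h : PairEquiv EY X EY' X') :
    PairEquiv F (LinearMap.range (S.phiL u)) F' (LinearMap.range (S'.phiL u)) := by
  obtain ⟨Φ, hΦ⟩ := h
  have hmem : ∀ x ∈ X, Φ.toEquiv x ∈ X' := by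
    intro x hx
    rw [← hΦ]
    exact ⟨x, hx, rfl⟩
  have hex : ∀ y, EX' (Φ.toEquiv y) = Φ.toEquiv (EX y) := by
    intro y
    rw [← sub_eq_zero]
    have hd : EX' (Φ.toEquiv y) - Φ.toEquiv (EX y) ∈ X' :=
      sub_mem (S'.ex.mem _) (hmem _ (S.ex.mem _))
    apply EY'.linn_definite
    rw [linn_sub_left]
    rw [← hΦ] at hd
    obtain ⟨x, hx, hx'⟩ := hd
    have hx'' : Φ.toEquiv x = EX' (Φ.toEquiv y) - Φ.toEquiv (EX y) := hx'
    rw [← hx'', Φ.map_linn, ← S'.ex.cond3 _ _ (hmem x hx), ← S.ex.cond3 _ _ hx, Φ.map_linn,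
      sub_self]
  obtain ⟨Ψ, hΨ⟩ := exists_iso F F' (fun p : C × Y × C => τ p.1 p.2.1 p.2.2)
    (fun p : C × Y × C => τ' p.1 (Φ.toEquiv p.2.1) p.2.2)
    (by
      rw [eq_top_iff, ← S.tau_top hu hbc]
      refine Submodule.span_mono ?_
      rintro _ ⟨c, d, x, hx, rfl⟩
      exact ⟨(c, x, d), rfl⟩)
    (by
      rw [eq_top_iff, ← S'.tau_top hu hbc]
      refine Submodule.span_mono ?_
      rintro _ ⟨c, d, x, hx, rfl⟩
      exact ⟨(c, Φ.toEquiv.symm x, d), by simp⟩)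
    (by
      rintro ⟨c, x, d⟩ ⟨c', x', d'⟩
      simp only [S.linn_eq, S'.linn_eq, ← Φ.map_rsmul, hex, Φ.map_linn])
    (by
      rintro ⟨c, x, d⟩ ⟨c', x', d'⟩
      simp only [S.rinn_eq, S'.rinn_eq, ← Φ.map_lsmul, hex, Φ.map_rinn])
  have hphi : ∀ y, Ψ.toEquiv (phi u EY τ y) = phi u EY' τ' (Φ.toEquiv y) := by
    intro y
    have h2 : ∀ c y d, Ψ.toEquiv (τ c y d) = τ' c (Φ.toEquiv y) d := fun c y d => hΨ (c, y, d)
    simp only [phi, map_sum, h2, Φ.map_lsmul, Φ.map_rsmul]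
  refine ⟨Ψ, ?_⟩
  ext v
  constructor
  · rintro ⟨_, ⟨y, rfl⟩, rfl⟩
    exact ⟨Φ.toEquiv y, (hphi y).symm⟩
  · rintro ⟨y, rfl⟩
    refine ⟨_, ⟨Φ.toEquiv.symm y, rfl⟩, ?_⟩
    refine (hphi _).trans ?_
    rw [LinearEquiv.apply_symm_apply]
    rfl

end PartB

section Tensor

variable {C Y W V : Type*} [CStarAlgebra C] [PartialOrder C] [StarOrderedRing C]
    [NormedAddCommGroup Y] [NormedSpace ℂ Y] [CompleteSpace Y]
    [NormedAddCommGroup W] [NormedSpace ℂ W] [CompleteSpace W]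
    [NormedAddCommGroup V] [NormedSpace ℂ V] [CompleteSpace V]
    {E : EquivBimodule C C Y} {G : EquivBimodule C C W} {F : EquivBimodule C C V} {s : Y → W → V}

theorem ten_sum_left (h : IsTensorProd E G F s) {J : Type*} (S : Finset J) (f : J → Y) (w : W) :
    s (∑ i ∈ S, f i) w = ∑ i ∈ S, s (f i) w :=
  map_sum (AddMonoidHom.mk' (fun y => s y w) (fun a b => h.add_left a b w)) f S

theorem ten_sum_right (h : IsTensorProd E G F s) {J : Type*} (S : Finset J) (f : J → W) (y : Y) :
    s y (∑ i ∈ S, f i) = ∑ i ∈ S, s y (f i) :=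
  map_sum (AddMonoidHom.mk' (fun w => s y w) (fun a b => h.add_right y a b)) f S

theorem ten_zero_right (h : IsTensorProd E G F s) (y : Y) : s y 0 = 0 := by
  simpa using h.smul_right 0 y 0

theorem linn_span_le (E : EquivBimodule C C Y) {I : Type*} (g : I → Y)
    (hg : Submodule.span ℂ (Set.range g) = ⊤) :
    (1 : C) ∈ Submodule.span ℂ {c : C | ∃ i j, c = E.linn (g i) (g j)} := by
  have h1 : (1 : C) ∈ Submodule.span ℂ {c : C | ∃ x y, c = E.linn x y} := by
    rw [span_linn_top]; trivial
  refine Submodule.span_le.2 ?_ h1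
  rintro _ ⟨x, y, rfl⟩
  have hx : x ∈ Submodule.span ℂ (Set.range g) := by rw [hg]; trivial
  have hy : y ∈ Submodule.span ℂ (Set.range g) := by rw [hg]; trivial
  induction hx using Submodule.span_induction with
  | mem x hx =>
    obtain ⟨i, rfl⟩ := hx
    induction hy using Submodule.span_induction with
    | mem x hx =>
      obtain ⟨j, rfl⟩ := hx
      exact Submodule.subset_span ⟨i, j, rfl⟩
    | zero => rw [linn_zero_right]; exact zero_mem _
    | add a b _ _ ha hb => rw [linn_add_right]; exact add_mem ha hb
    | smul a b _ hb => rw [linn_smul_right]; exact Submodule.smul_mem _ _ hb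
  | zero => rw [linn_zero_left]; exact zero_mem _
  | add a b _ _ ha hb => rw [E.linn_add_left]; exact add_mem ha hb
  | smul a b _ hb => rw [E.linn_smul_left]; exact Submodule.smul_mem _ _ hb

end Tensor

section PartC

variable {A C C₁ Y₁ T₁ Y₂ T₂ V Tp Th : Type*}
    [CStarAlgebra A] [CStarAlgebra C] [CStarAlgebra C₁]
    [PartialOrder A] [StarOrderedRing A] [PartialOrder C] [StarOrderedRing C]
    [PartialOrder C₁] [StarOrderedRing C₁]
    [NormedAddCommGroup Y₁] [NormedSpace ℂ Y₁] [CompleteSpace Y₁]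
    [NormedAddCommGroup T₁] [NormedSpace ℂ T₁] [CompleteSpace T₁]
    [NormedAddCommGroup Y₂] [NormedSpace ℂ Y₂] [CompleteSpace Y₂]
    [NormedAddCommGroup T₂] [NormedSpace ℂ T₂] [CompleteSpace T₂]
    [NormedAddCommGroup V] [NormedSpace ℂ V] [CompleteSpace V]
    [NormedAddCommGroup Tp] [NormedSpace ℂ Tp] [CompleteSpace Tp]
    [NormedAddCommGroup Th] [NormedSpace ℂ Th] [CompleteSpace Th]
    {ι : A →⋆ₐ[ℂ] C} {EA : CondExpectation ι} {ιC : C →⋆ₐ[ℂ] C₁} {eA : C₁}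
    {E₁ : EquivBimodule C C Y₁} {X₁ : Submodule ℂ Y₁} {EX₁ : Y₁ → Y₁}
    {F₁ : EquivBimodule C₁ C₁ T₁} {τ₁ : C → Y₁ → C → T₁}
    {E₂ : EquivBimodule C C Y₂} {X₂ : Submodule ℂ Y₂} {EX₂ : Y₂ → Y₂}
    {F₂ : EquivBimodule C₁ C₁ T₂} {τ₂ : C → Y₂ → C → T₂}
    {G : EquivBimodule C C V} {XV : Submodule ℂ V} {EV : V → V}
    {Gp : EquivBimodule C₁ C₁ Tp} {ρ : C → V → C → Tp}
    {s : Y₁ → Y₂ → V} {H : EquivBimodule C₁ C₁ Th} {q : T₁ → T₂ → Th}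

theorem rsmul_mem (S : Sys ι EA ιC eA E₁ X₁ EX₁ F₁ τ₁) {x : Y₁} (hx : x ∈ X₁) (a : A) :
    E₁.rsmul x (ι a) ∈ X₁ := by
  have := S.ex.cond5 a x
  rw [ex_self S.ex hx] at this
  rw [← this]
  exact S.ex.mem _

theorem lsmul_mem (S : Sys ι EA ιC eA E₁ X₁ EX₁ F₁ τ₁) {x : Y₁} (hx : x ∈ X₁) (a : A) :
    E₁.lsmul (ι a) x ∈ X₁ := by
  have := S.ex.cond2 a x
  rw [ex_self S.ex hx] at this
  rw [← this]
  exact S.ex.mem _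

theorem exists_linn (S : Sys ι EA ιC eA E₁ X₁ EX₁ F₁ τ₁) {x y : Y₁} (hx : x ∈ X₁) (hy : y ∈ X₁) :
    ∃ a, E₁.linn x y = ι a := by
  have := S.linn_ex hx y
  rw [ex_self S.ex hy] at this
  exact ⟨_, this⟩

theorem exists_rinn (S : Sys ι EA ιC eA E₁ X₁ EX₁ F₁ τ₁) {x y : Y₁} (hx : x ∈ X₁) (hy : y ∈ X₁) :
    ∃ a, E₁.rinn x y = ι a := by
  have := S.rinn_ex hx y
  rw [ex_self S.ex hy] at this
  exact ⟨_, this⟩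

theorem one_mem_ten (S₁ : Sys ι EA ιC eA E₁ X₁ EX₁ F₁ τ₁)
    (S₂ : Sys ι EA ιC eA E₂ X₂ EX₂ F₂ τ₂) (hs : IsTensorProd E₁ E₂ G s) :
    (1 : C) ∈ Submodule.span ℂ {c : C | ∃ v ∈ {v : V | ∃ x ∈ X₁, ∃ z ∈ X₂, v = s x z},
      ∃ v' ∈ {v : V | ∃ x ∈ X₁, ∃ z ∈ X₂, v = s x z}, c = G.linn v v'} := by
  refine Submodule.span_le.2 ?_ S₁.one_l
  rintro _ ⟨x, hx, x', hx', rfl⟩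
  have key : ∀ b ∈ Submodule.span ℂ {c : C | ∃ x ∈ X₂, ∃ y ∈ X₂, c = E₂.linn x y},
      E₁.linn (E₁.rsmul x b) x' ∈ Submodule.span ℂ {c : C | ∃ v ∈ {v : V | ∃ x ∈ X₁, ∃ z ∈ X₂,
        v = s x z}, ∃ v' ∈ {v : V | ∃ x ∈ X₁, ∃ z ∈ X₂, v = s x z}, c = G.linn v v'} := by
    intro b hb
    induction hb using Submodule.span_induction with
    | mem b h =>
      obtain ⟨z, hz, z', hz', rfl⟩ := h
      rw [← hs.map_linn]
      exact Submodule.subset_span ⟨_, ⟨x, hx, z, hz, rfl⟩, _, ⟨x', hx', z', hz', rfl⟩, rfl⟩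
    | zero => rw [zero_rsmul, linn_zero_left]; exact zero_mem _
    | add a b _ _ ha hb => rw [E₁.rsmul_add, E₁.linn_add_left]; exact add_mem ha hb
    | smul a b _ hb =>
      rw [E₁.smul_rsmul, E₁.linn_smul_left]; exact Submodule.smul_mem _ _ hb
  have := key 1 S₂.one_l
  rwa [rsmul_one] at this

theorem ten_top (S₁ : Sys ι EA ιC eA E₁ X₁ EX₁ F₁ τ₁)
    (S₂ : Sys ι EA ιC eA E₂ X₂ EX₂ F₂ τ₂) (hs : IsTensorProd E₁ E₂ G s) :
    Submodule.span ℂ {v : V | ∃ y w, v = s y w} = ⊤ := by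
  apply top_of_one_mem G
  · intro p hp d
    induction hp using Submodule.span_induction with
    | mem p h =>
      obtain ⟨y, w, rfl⟩ := h
      rw [hs.map_rsmul]
      exact Submodule.subset_span ⟨_, _, rfl⟩
    | zero => rw [rsmul_zero]; exact zero_mem _
    | add a b _ _ ha hb => rw [G.add_rsmul]; exact add_mem ha hb
    | smul a b _ hb => rw [G.rsmul_smul]; exact Submodule.smul_mem _ _ hb
  · refine Submodule.span_mono ?_ (one_mem_ten S₁ S₂ hs)
    rintro _ ⟨_, ⟨x, hx, z, hz, rfl⟩, v', _, rfl⟩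
    exact ⟨_, Submodule.subset_span ⟨x, z, rfl⟩, v', rfl⟩

theorem ten_linn (S₁ : Sys ι EA ιC eA E₁ X₁ EX₁ F₁ τ₁)
    (S₂ : Sys ι EA ιC eA E₂ X₂ EX₂ F₂ τ₂) (SV : Sys ι EA ιC eA G XV EV Gp ρ)
    (hs : IsTensorProd E₁ E₂ G s) (hsX : ∀ x ∈ X₁, ∀ z ∈ X₂, s x z ∈ XV)
    (hq : IsTensorProd F₁ F₂ H q) {x x' : Y₁} {z z' : Y₂} (hx : x ∈ X₁) (hx' : x' ∈ X₁)
    (hz : z ∈ X₂) (hz' : z' ∈ X₂) (c c' d d' : C) :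
    H.linn (q (τ₁ c x 1) (τ₂ 1 z d)) (q (τ₁ c' x' 1) (τ₂ 1 z' d')) =
      Gp.linn (ρ c (s x z) d) (ρ c' (s x' z') d') := by
  have hzE := rsmul_mem S₂ hz (EA.toFun (star d * d'))
  obtain ⟨a, ha⟩ := exists_linn S₂ hzE hz'
  have h1 : F₂.linn (τ₂ 1 z d) (τ₂ 1 z' d') = ιC (ι a) * eA := by
    rw [S₂.linn_eq, ex_self S₂.ex hzE, ex_self S₂.ex hz', ha]
    simp
  have h2 : F₁.rsmul (τ₁ c x 1) (ιC (ι a) * eA) = τ₁ c (E₁.rsmul x (ι a)) 1 := by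
    rw [F₁.rsmul_mul, S₁.map_rsmul, S₁.map_eB, S₁.bal₂, ← map_star, mul_one, EA.retraction,
      one_mul]
  rw [hq.map_linn, h1, h2, S₁.linn_eq, SV.linn_eq, hs.map_rsmul,
    ex_self SV.ex (hsX _ hx _ hzE), ex_self SV.ex (hsX _ hx' _ hz'), hs.map_linn, ha,
    star_one, one_mul, ce_one, map_one, rsmul_one, ex_self S₁.ex (rsmul_mem S₁ hx a),
    ex_self S₁.ex hx']

theorem ten_rinn (S₁ : Sys ι EA ιC eA E₁ X₁ EX₁ F₁ τ₁)
    (S₂ : Sys ι EA ιC eA E₂ X₂ EX₂ F₂ τ₂) (SV : Sys ι EA ιC eA G XV EV Gp ρ)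
    (hs : IsTensorProd E₁ E₂ G s) (hsX : ∀ x ∈ X₁, ∀ z ∈ X₂, s x z ∈ XV)
    (hq : IsTensorProd F₁ F₂ H q) {x x' : Y₁} {z z' : Y₂} (hx : x ∈ X₁) (hx' : x' ∈ X₁)
    (hz : z ∈ X₂) (hz' : z' ∈ X₂) (c c' d d' : C) :
    H.rinn (q (τ₁ c x 1) (τ₂ 1 z d)) (q (τ₁ c' x' 1) (τ₂ 1 z' d')) =
      Gp.rinn (ρ c (s x z) d) (ρ c' (s x' z') d') := by
  have hzE := lsmul_mem S₁ hx' (EA.toFun (star c * c'))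
  obtain ⟨a, ha⟩ := exists_rinn S₁ hx hzE
  have h1 : F₁.rinn (τ₁ c x 1) (τ₁ c' x' 1) = eA * ιC (ι a) := by
    rw [S₁.rinn_eq, ex_self S₁.ex hzE, ex_self S₁.ex hx, ha]
    simp
  have h2 : F₂.lsmul (eA * ιC (ι a)) (τ₂ 1 z' d') = τ₂ 1 (E₂.lsmul (ι a) z') d' := by
    rw [F₂.mul_lsmul, S₂.map_lsmul, S₂.map_eA, ← S₂.bal₁, mul_one, EA.retraction,
      one_mul]
  rw [hq.map_rinn, h1, h2, S₂.rinn_eq, SV.rinn_eq, hs.map_lsmul,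
    ex_self SV.ex (hsX _ hzE _ hz'), ex_self SV.ex (hsX _ hx _ hz), hs.map_rinn, ha,
    star_one, one_mul, ce_one, map_one, one_lsmul, ex_self S₂.ex (lsmul_mem S₂ hz' a),
    ex_self S₂.ex hz]

theorem EV_ten (S₁ : Sys ι EA ιC eA E₁ X₁ EX₁ F₁ τ₁)
    (S₂ : Sys ι EA ιC eA E₂ X₂ EX₂ F₂ τ₂) (SV : Sys ι EA ιC eA G XV EV Gp ρ)
    (hs : IsTensorProd E₁ E₂ G s) (hsX : ∀ x ∈ X₁, ∀ z ∈ X₂, s x z ∈ XV)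
    {n : ℕ} {u : Fin n → C} (hu : IsQuasiBasis EA u) (y : Y₁) (w : Y₂) :
    EV (s y w) = ∑ j, s (EX₁ (E₁.rsmul y (u j))) (EX₂ (E₂.lsmul (star (u j)) w)) := by
  have key : ∀ x ∈ X₁, ∀ w, EV (s x w) = s x (EX₂ w) := by
    intro x hx w
    have hw : w ∈ Submodule.span ℂ {y : Y₂ | ∃ x ∈ X₂, ∃ c, y = E₂.rsmul x c} := by
      rw [S₂.xc]; trivial
    induction hw using Submodule.span_induction with
    | mem w h =>
      obtain ⟨z, hz, c, rfl⟩ := h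
      rw [S₂.ex.cond4 _ _ hz, ← hs.map_rsmul, ← hs.map_rsmul, SV.ex.cond4 _ _ (hsX _ hx _ hz)]
    | zero => rw [ten_zero_right hs, SV.ex_zero, S₂.ex_zero, ten_zero_right hs]
    | add a b _ _ ha hb => rw [hs.add_right, SV.ex.map_add, ha, hb, S₂.ex.map_add, hs.add_right]
    | smul a b _ hb => rw [hs.smul_right, SV.ex.map_smul, hb, S₂.ex.map_smul, hs.smul_right]
  conv_lhs => rw [← S₁.rec_r hu y]
  rw [ten_sum_left hs, SV.ex_sum]
  refine Finset.sum_congr rfl fun j _ => ?_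
  rw [hs.balanced, key _ (S₁.ex.mem _)]

/-- Part (c). -/
theorem partC (S₁ : Sys ι EA ιC eA E₁ X₁ EX₁ F₁ τ₁)
    (S₂ : Sys ι EA ιC eA E₂ X₂ EX₂ F₂ τ₂) (SV : Sys ι EA ιC eA G XV EV Gp ρ)
    (hs : IsTensorProd E₁ E₂ G s) (hsX : ∀ x ∈ X₁, ∀ z ∈ X₂, s x z ∈ XV)
    (hq : IsTensorProd F₁ F₂ H q)
    {n : ℕ} {u : Fin n → C}
    (hu : IsQuasiBasis EA u) (hbc : IsBasicConstruction ι EA ιC eA) :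
    PairEquiv Gp (LinearMap.range (SV.phiL u)) H
      ((Submodule.span ℂ {vv : Th | ∃ a ∈ LinearMap.range (S₁.phiL u),
        ∃ b ∈ LinearMap.range (S₂.phiL u), vv = q a b}).topologicalClosure) := by
  have hg : Submodule.span ℂ (Set.range fun p : C × X₁ × X₂ × C =>
      ρ p.1 (s p.2.1 p.2.2.1) p.2.2.2) = ⊤ := by
    rw [eq_top_iff, ← SV.span_tau_top hu hbc {v : V | ∃ x ∈ X₁, ∃ z ∈ X₂, v = s x z}
      (by rintro _ ⟨x, hx, z, hz, rfl⟩; exact hsX _ hx _ hz) (one_mem_ten S₁ S₂ hs)]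
    refine Submodule.span_mono ?_
    rintro _ ⟨c, d, _, ⟨x, hx, z, hz, rfl⟩, rfl⟩
    exact ⟨(c, ⟨x, hx⟩, ⟨z, hz⟩, d), rfl⟩
  have hl : ∀ i j : C × X₁ × X₂ × C,
      H.linn (q (τ₁ i.1 i.2.1 1) (τ₂ 1 i.2.2.1 i.2.2.2))
        (q (τ₁ j.1 j.2.1 1) (τ₂ 1 j.2.2.1 j.2.2.2)) =
      Gp.linn (ρ i.1 (s i.2.1 i.2.2.1) i.2.2.2) (ρ j.1 (s j.2.1 j.2.2.1) j.2.2.2) :=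
    fun i j => ten_linn S₁ S₂ SV hs hsX hq i.2.1.2 j.2.1.2 i.2.2.1.2 j.2.2.1.2 _ _ _ _
  have hr : ∀ i j : C × X₁ × X₂ × C,
      H.rinn (q (τ₁ i.1 i.2.1 1) (τ₂ 1 i.2.2.1 i.2.2.2))
        (q (τ₁ j.1 j.2.1 1) (τ₂ 1 j.2.2.1 j.2.2.2)) =
      Gp.rinn (ρ i.1 (s i.2.1 i.2.2.1) i.2.2.2) (ρ j.1 (s j.2.1 j.2.2.1) j.2.2.2) :=
    fun i j => ten_rinn S₁ S₂ SV hs hsX hq i.2.1.2 j.2.1.2 i.2.2.1.2 j.2.2.1.2 _ _ _ _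
  have hh : Submodule.span ℂ (Set.range fun p : C × X₁ × X₂ × C =>
      q (τ₁ p.1 p.2.1 1) (τ₂ 1 p.2.2.1 p.2.2.2)) = ⊤ := by
    apply top_of_one_mem H
    · intro p hp g
      induction hp using Submodule.span_induction with
      | mem p h =>
        obtain ⟨⟨c, x, z, d⟩, rfl⟩ := h
        have hg := hbc.span g
        induction hg using Submodule.span_induction with
        | mem g h =>
          obtain ⟨c', d', rfl⟩ := h
          simp only [hq.map_rsmul]
          rw [F₂.rsmul_mul, F₂.rsmul_mul, S₂.map_rsmul, S₂.map_eB, S₂.map_rsmul]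
          exact Submodule.subset_span ⟨(c, x, z, _), rfl⟩
        | zero => rw [zero_rsmul]; exact zero_mem _
        | add a b _ _ ha hb => rw [H.rsmul_add]; exact add_mem ha hb
        | smul a b _ hb => rw [H.smul_rsmul]; exact Submodule.smul_mem _ _ hb
      | zero => rw [rsmul_zero]; exact zero_mem _
      | add a b _ _ ha hb => rw [H.add_rsmul]; exact add_mem ha hb
      | smul a b _ hb => rw [H.rsmul_smul]; exact Submodule.smul_mem _ _ hb
    · refine Submodule.span_mono ?_ (linn_span_le Gp _ hg)
      rintro _ ⟨i, j, rfl⟩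
      exact ⟨_, Submodule.subset_span ⟨i, rfl⟩, _, (hl i j).symm⟩
  obtain ⟨Ψ, hΨ⟩ := exists_iso Gp H _ _ hg hh hl hr
  have hΨ' : ∀ c d, ∀ x ∈ X₁, ∀ z ∈ X₂, Ψ.toEquiv (ρ c (s x z) d) =
      q (τ₁ c x 1) (τ₂ 1 z d) := fun c d x hx z hz => hΨ (c, ⟨x, hx⟩, ⟨z, hz⟩, d)
  have hten : ∀ c d c' d' y w, q (τ₁ c y d) (τ₂ c' w d') =
      Ψ.toEquiv (ρ c (s (EX₁ y) (EX₂ (E₂.lsmul (ι (EA.toFun (star d * c'))) w))) d') := by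
    intro c d c' d' y w
    have h1 : τ₁ c y d = F₁.rsmul (F₁.rsmul (τ₁ c (EX₁ y) 1) eA) (ιC (star d)) := by
      rw [S₁.map_eB, ce_one, map_one, S₁.map_rsmul, star_star, mul_one, S₁.ex_eq]
    rw [hΨ' _ _ _ (S₁.ex.mem _) _ (S₂.ex.mem _), S₂.ex_eq, ← S₂.bal₁, one_mul, h1,
      hq.balanced, hq.balanced, S₂.map_lsmul, S₂.map_eA]
  have hphi : ∀ y w, Ψ.toEquiv (phi u G ρ (s y w)) = q (phi u E₁ τ₁ y) (phi u E₂ τ₂ w) := by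
    intro y w
    have hk : ∀ j l, ∑ k, EX₂ (E₂.lsmul (ι (EA.toFun (star (u j) * u k)))
        (E₂.lsmul (star (u k)) (E₂.rsmul w (u l)))) =
        EX₂ (E₂.lsmul (star (u j)) (E₂.rsmul w (u l))) := by
      intro j l
      simp only [← S₂.ex_sum, ← E₂.mul_lsmul, ← sum_lsmul, (hu (star (u j))).2]
    have hL : ∀ i l, ρ (u i) (G.lsmul (star (u i)) (G.rsmul (s y w) (u l))) (u l) =
        ∑ j, ∑ k, ρ (u i) (s (EX₁ (E₁.lsmul (star (u i)) (E₁.rsmul y (u j))))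
          (EX₂ (E₂.lsmul (ι (EA.toFun (star (u j) * u k)))
        (E₂.lsmul (star (u k)) (E₂.rsmul w (u l)))))) (u l) := by
      intro i l
      simp only [← SV.sum₂, ← ten_sum_right hs, hk]
      rw [← SV.ex_eq, hs.map_rsmul, hs.map_lsmul, EV_ten S₁ S₂ SV hs hsX hu]
      simp only [E₁.lsmul_rsmul]
    have hR : q (phi u E₁ τ₁ y) (phi u E₂ τ₂ w) = ∑ i, ∑ j, ∑ k, ∑ l,
        q (τ₁ (u i) (E₁.lsmul (star (u i)) (E₁.rsmul y (u j))) (u j))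
          (τ₂ (u k) (E₂.lsmul (star (u k)) (E₂.rsmul w (u l))) (u l)) := by
      simp only [phi, ten_sum_left hq, ten_sum_right hq]
    rw [hR, phi, map_sum]
    refine Finset.sum_congr rfl fun i _ => ?_
    simp only [hL, hten, map_sum]
    rw [Finset.sum_comm]
    refine Finset.sum_congr rfl fun j _ => ?_
    rw [Finset.sum_comm]
  have hspan : (Submodule.span ℂ {vv : Th | ∃ a ∈ LinearMap.range (S₁.phiL u),
        ∃ b ∈ LinearMap.range (S₂.phiL u), vv = q a b}) =
      LinearMap.range (Ψ.toEquiv.toLinearMap ∘ₗ SV.phiL u) := by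
    rw [LinearMap.range_eq_map (Ψ.toEquiv.toLinearMap ∘ₗ SV.phiL u), ← ten_top S₁ S₂ hs, Submodule.map_span]
    congr 1
    ext v
    constructor
    · rintro ⟨_, ⟨y, rfl⟩, _, ⟨w, rfl⟩, rfl⟩
      exact ⟨_, ⟨y, w, rfl⟩, hphi y w⟩
    · rintro ⟨_, ⟨y, w, rfl⟩, rfl⟩
      exact ⟨_, ⟨y, rfl⟩, _, ⟨w, rfl⟩, hphi y w⟩
  have hiso : ∀ v, ‖Ψ.toEquiv v‖ = ‖v‖ := by
    intro v
    have : ‖Ψ.toEquiv v‖ ^ 2 = ‖v‖ ^ 2 := by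
      rw [← H.norm_linn, Ψ.map_linn, Gp.norm_linn]
    exact (sq_eq_sq₀ (norm_nonneg _) (norm_nonneg _)).1 this
  have hcl : IsClosed ((LinearMap.range (Ψ.toEquiv.toLinearMap ∘ₗ SV.phiL u) :
      Submodule ℂ Th) : Set Th) := by
    have : Isometry (Ψ.toEquiv.toLinearMap ∘ₗ SV.phiL u) :=
      AddMonoidHomClass.isometry_of_norm _ fun v => (hiso _).trans (SV.norm_phi hu hbc v)
    rw [LinearMap.coe_range]
    exact this.isClosedEmbedding.isClosed_range
  refine ⟨Ψ, ?_⟩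
  rw [hspan, hcl.submodule_topologicalClosure_eq, LinearMap.range_comp]

end PartC

end PicAux

/-- Let `A ⊆ C` be a unital inclusion of unital C*-algebras with
`A' ∩ C = ℂ1` and `E^A : C → A` a conditional expectation of Watatani index-finite type
with C*-basic construction `C₁`.  Then `f : Pic(A, C) → Pic(C, C₁)`,
`f([X, Y]) = [Y, Y₁]` (`Y₁` the upward basic construction of `Y`, containing `Y` via the
canonical embedding `φ_Y`), is a well-defined group homomorphism: it maps `Equi(A,C)`
into `Equi(C,C₁)`, respects the equivalence relation, and is multiplicative. -/
theorem f_well_defined_homomorphism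
    {A C C₁ : Type*} [CStarAlgebra A] [CStarAlgebra C] [CStarAlgebra C₁]
    [PartialOrder A] [StarOrderedRing A] [PartialOrder C] [StarOrderedRing C]
    [PartialOrder C₁] [StarOrderedRing C₁]
    (ι : A →⋆ₐ[ℂ] C) (hι : Function.Injective ι)
    (EA : CondExpectation ι) {n : ℕ} (u : Fin n → C) (hu : IsQuasiBasis EA u)
    (hirr : IrreducibleIncl ι)
    (ιC : C →⋆ₐ[ℂ] C₁) (eA : C₁) (hbc : IsBasicConstruction ι EA ιC eA) :
    -- (a) well-definedness: `(φ_Y(Y), Y₁) ∈ Equi(C, C₁)`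
    (∀ (Yt : Type*) [NormedAddCommGroup Yt] [NormedSpace ℂ Yt] [CompleteSpace Yt]
      (EY : EquivBimodule C C Yt) (X : Submodule ℂ Yt), IsEquiPair ⇑ι EY X →
      ∀ [CompleteSpace X] (MX : EquivBimodule A A X), IsRestriction ⇑ι ⇑ι EY X MX →
      ∀ (EX : Yt → Yt) (hEX : IsBimodCondExp ι ι EA EA EY X EX)
      (T : Type*) [NormedAddCommGroup T] [NormedSpace ℂ T] [CompleteSpace T]
      (F : EquivBimodule C₁ C₁ T) (t : C → X → C → T),
      IsUpwardBasic ι ι EA EA MX ιC eA ιC eA F t →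
        IsEquiPair ⇑ιC F
          ((Submodule.span ℂ (Set.range fun y : Yt => ∑ i, ∑ j, t (u i)
            ⟨EX (EY.lsmul (star (u i)) (EY.rsmul y (u j))), hEX.mem _⟩
            (u j))).topologicalClosure)) ∧
    -- (b) `f` respects the equivalence relation on `Equi(A, C)`
    (∀ (Y₁t : Type*) [NormedAddCommGroup Y₁t] [NormedSpace ℂ Y₁t] [CompleteSpace Y₁t]
      (EY₁ : EquivBimodule C C Y₁t) (X₁ : Submodule ℂ Y₁t), IsEquiPair ⇑ι EY₁ X₁ →
      ∀ [CompleteSpace X₁] (MX₁ : EquivBimodule A A X₁), IsRestriction ⇑ι ⇑ι EY₁ X₁ MX₁ →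
      ∀ (EX₁ : Y₁t → Y₁t) (hEX₁ : IsBimodCondExp ι ι EA EA EY₁ X₁ EX₁)
      (T₁ : Type*) [NormedAddCommGroup T₁] [NormedSpace ℂ T₁] [CompleteSpace T₁]
      (F₁ : EquivBimodule C₁ C₁ T₁) (t₁ : C → X₁ → C → T₁),
      IsUpwardBasic ι ι EA EA MX₁ ιC eA ιC eA F₁ t₁ →
      ∀ (Y₂t : Type*) [NormedAddCommGroup Y₂t] [NormedSpace ℂ Y₂t] [CompleteSpace Y₂t]
      (EY₂ : EquivBimodule C C Y₂t) (X₂ : Submodule ℂ Y₂t), IsEquiPair ⇑ι EY₂ X₂ →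
      ∀ [CompleteSpace X₂] (MX₂ : EquivBimodule A A X₂), IsRestriction ⇑ι ⇑ι EY₂ X₂ MX₂ →
      ∀ (EX₂ : Y₂t → Y₂t) (hEX₂ : IsBimodCondExp ι ι EA EA EY₂ X₂ EX₂)
      (T₂ : Type*) [NormedAddCommGroup T₂] [NormedSpace ℂ T₂] [CompleteSpace T₂]
      (F₂ : EquivBimodule C₁ C₁ T₂) (t₂ : C → X₂ → C → T₂),
      IsUpwardBasic ι ι EA EA MX₂ ιC eA ιC eA F₂ t₂ →
      PairEquiv EY₁ X₁ EY₂ X₂ →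
        PairEquiv F₁
          ((Submodule.span ℂ (Set.range fun y : Y₁t => ∑ i, ∑ j, t₁ (u i)
            ⟨EX₁ (EY₁.lsmul (star (u i)) (EY₁.rsmul y (u j))), hEX₁.mem _⟩
            (u j))).topologicalClosure)
          F₂
          ((Submodule.span ℂ (Set.range fun y : Y₂t => ∑ i, ∑ j, t₂ (u i)
            ⟨EX₂ (EY₂.lsmul (star (u i)) (EY₂.rsmul y (u j))), hEX₂.mem _⟩
            (u j))).topologicalClosure)) ∧
    -- (c) multiplicativity: `f([X₁,Y₁][X₂,Y₂]) = f([X₁,Y₁]) f([X₂,Y₂])`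
    (∀ (Y₁t : Type*) [NormedAddCommGroup Y₁t] [NormedSpace ℂ Y₁t] [CompleteSpace Y₁t]
      (EY₁ : EquivBimodule C C Y₁t) (X₁ : Submodule ℂ Y₁t), IsEquiPair ⇑ι EY₁ X₁ →
      ∀ [CompleteSpace X₁] (MX₁ : EquivBimodule A A X₁), IsRestriction ⇑ι ⇑ι EY₁ X₁ MX₁ →
      ∀ (EX₁ : Y₁t → Y₁t) (hEX₁ : IsBimodCondExp ι ι EA EA EY₁ X₁ EX₁)
      (T₁ : Type*) [NormedAddCommGroup T₁] [NormedSpace ℂ T₁] [CompleteSpace T₁]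
      (F₁ : EquivBimodule C₁ C₁ T₁) (t₁ : C → X₁ → C → T₁),
      IsUpwardBasic ι ι EA EA MX₁ ιC eA ιC eA F₁ t₁ →
      ∀ (Y₂t : Type*) [NormedAddCommGroup Y₂t] [NormedSpace ℂ Y₂t] [CompleteSpace Y₂t]
      (EY₂ : EquivBimodule C C Y₂t) (X₂ : Submodule ℂ Y₂t), IsEquiPair ⇑ι EY₂ X₂ →
      ∀ [CompleteSpace X₂] (MX₂ : EquivBimodule A A X₂), IsRestriction ⇑ι ⇑ι EY₂ X₂ MX₂ →
      ∀ (EX₂ : Y₂t → Y₂t) (hEX₂ : IsBimodCondExp ι ι EA EA EY₂ X₂ EX₂)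
      (T₂ : Type*) [NormedAddCommGroup T₂] [NormedSpace ℂ T₂] [CompleteSpace T₂]
      (F₂ : EquivBimodule C₁ C₁ T₂) (t₂ : C → X₂ → C → T₂),
      IsUpwardBasic ι ι EA EA MX₂ ιC eA ιC eA F₂ t₂ →
      -- a realization of the product `[X₁ ⊗_A X₂, Y₁ ⊗_C Y₂]`
      ∀ (Vp : Type*) [NormedAddCommGroup Vp] [NormedSpace ℂ Vp] [CompleteSpace Vp]
      (G : EquivBimodule C C Vp) (XV : Submodule ℂ Vp) (s : Y₁t → Y₂t → Vp),
      IsPairTensor ⇑ι EY₁ X₁ EY₂ X₂ G XV s →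
      ∀ [CompleteSpace XV] (MXV : EquivBimodule A A XV), IsRestriction ⇑ι ⇑ι G XV MXV →
      ∀ (EX₁₂ : Vp → Vp) (hEX₁₂ : IsBimodCondExp ι ι EA EA G XV EX₁₂)
      (Tp : Type*) [NormedAddCommGroup Tp] [NormedSpace ℂ Tp] [CompleteSpace Tp]
      (Gp : EquivBimodule C₁ C₁ Tp) (rp : C → XV → C → Tp),
      IsUpwardBasic ι ι EA EA MXV ιC eA ιC eA Gp rp →
      -- a realization of the product `f([X₁,Y₁]) f([X₂,Y₂])` over `(C, C₁)`
      ∀ (Th : Type*) [NormedAddCommGroup Th] [NormedSpace ℂ Th] [CompleteSpace Th]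
      (H : EquivBimodule C₁ C₁ Th) (q : T₁ → T₂ → Th), IsTensorProd F₁ F₂ H q →
        PairEquiv Gp
          ((Submodule.span ℂ (Set.range fun v : Vp => ∑ i, ∑ j, rp (u i)
            ⟨EX₁₂ (G.lsmul (star (u i)) (G.rsmul v (u j))), hEX₁₂.mem _⟩
            (u j))).topologicalClosure)
          H
          ((Submodule.span ℂ {vv : Th |
            ∃ a ∈ (Submodule.span ℂ (Set.range fun y : Y₁t => ∑ i, ∑ j, t₁ (u i)
              ⟨EX₁ (EY₁.lsmul (star (u i)) (EY₁.rsmul y (u j))), hEX₁.mem _⟩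
              (u j))).topologicalClosure,
            ∃ b ∈ (Submodule.span ℂ (Set.range fun y : Y₂t => ∑ i, ∑ j, t₂ (u i)
              ⟨EX₂ (EY₂.lsmul (star (u i)) (EY₂.rsmul y (u j))), hEX₂.mem _⟩
              (u j))).topologicalClosure,
            vv = q a b}).topologicalClosure)) := by
  refine ⟨?_, ?_, ?_⟩
  · intro Yt _ _ _ EY X _ _ MX hM EX hEX T _ _ _ F t ht
    have S := PicAux.mkSys MX hM hEX t ht
    have h := S.isEquiPair hu hbc
    rw [← S.closure_eq hu hbc] at h
    exact h
  · intro Y₁t _ _ _ EY₁ X₁ _ _ MX₁ hM₁ EX₁ hEX₁ T₁ _ _ _ F₁ t₁ ht₁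
      Y₂t _ _ _ EY₂ X₂ _ _ MX₂ hM₂ EX₂ hEX₂ T₂ _ _ _ F₂ t₂ ht₂ hP
    have S₁ := PicAux.mkSys MX₁ hM₁ hEX₁ t₁ ht₁
    have S₂ := PicAux.mkSys MX₂ hM₂ hEX₂ t₂ ht₂
    have h := PicAux.partB S₁ S₂ hu hbc hP
    rw [← S₁.closure_eq hu hbc, ← S₂.closure_eq hu hbc] at h
    exact h
  · intro Y₁t _ _ _ EY₁ X₁ _ _ MX₁ hM₁ EX₁ hEX₁ T₁ _ _ _ F₁ t₁ ht₁
      Y₂t _ _ _ EY₂ X₂ _ _ MX₂ hM₂ EX₂ hEX₂ T₂ _ _ _ F₂ t₂ ht₂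
      Vp _ _ _ G XV s hP _ MXV hMV EX₁₂ hEX₁₂ Tp _ _ _ Gp rp hrp Th _ _ _ H q hq
    have S₁ := PicAux.mkSys MX₁ hM₁ hEX₁ t₁ ht₁
    have S₂ := PicAux.mkSys MX₂ hM₂ hEX₂ t₂ ht₂
    have SV := PicAux.mkSys MXV hMV hEX₁₂ rp hrp
    have hsX : ∀ x ∈ X₁, ∀ z ∈ X₂, s x z ∈ XV := by
      intro x hx z hz
      rw [← SetLike.mem_coe, hP.sub]
      exact subset_closure (Submodule.subset_span ⟨x, hx, z, hz, rfl⟩)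
    have h := PicAux.partC S₁ S₂ SV hP.tensor hsX hq hu hbc
    rw [← S₁.closure_eq hu hbc, ← S₂.closure_eq hu hbc, ← SV.closure_eq hu hbc] at h
    exact h

end
end

section
/- Let A ⊆ C be a unital inclusion of unital C*-algebras with A' ∩ C = C·1, E^A: C → A a conditional expectation of Watatani index-finite type, C_1 the C*-basic construction for E^A, E^C: C_1 → C the dual conditional expectation, and C_2 the C*-basic construction for E^C. Let f: Pic(A,C) → Pic(C,C_1), f([X,Y]) = [Y,Y_1]; let f_1: Pic(C,C_1) → Pic(C_1,C_2), f_1([Y,Y_1]) = [Y_1,Y_2] (upward basic constructions); and let g: Pic(A,C) → Pic(C_1,C_2) be the isomorphism g([X,Y]) = [C⊗_A X⊗_A C̃ , C_1⊗_C Y⊗_C C̃_1] coming from the strong Morita equivalence of A ⊆ C and C_1 ⊆ C_2. Then f_1 ∘ f = g on Pic(A,C). -/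
open scoped MultiplierAlgebra

noncomputable section

namespace EquivBimodule

section Basic

variable {C D Y : Type*}
    [NonUnitalCStarAlgebra C] [PartialOrder C] [StarOrderedRing C]
    [NonUnitalCStarAlgebra D] [PartialOrder D] [StarOrderedRing D]
    [NormedAddCommGroup Y] [NormedSpace ℂ Y] [CompleteSpace Y]
    (E : EquivBimodule C D Y)

theorem linn_add_right (x y z : Y) : E.linn x (y + z) = E.linn x y + E.linn x z := by
  rw [← E.linn_star, E.linn_add_left, star_add, E.linn_star, E.linn_star]

theorem linn_smul_right (t : ℂ) (x y : Y) : E.linn x (t • y) = star t • E.linn x y := by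
  rw [← E.linn_star, E.linn_smul_left, star_smul, E.linn_star]

theorem linn_lsmul_right (c : C) (x y : Y) : E.linn x (E.lsmul c y) = E.linn x y * star c := by
  rw [← E.linn_star, E.linn_lsmul_left, star_mul, E.linn_star]

theorem rinn_add_left (x y z : Y) : E.rinn (x + y) z = E.rinn x z + E.rinn y z := by
  rw [← E.rinn_star, E.rinn_add_right, star_add, E.rinn_star, E.rinn_star]

theorem rinn_smul_left (t : ℂ) (x y : Y) : E.rinn (t • x) y = star t • E.rinn x y := by
  rw [← E.rinn_star, E.rinn_smul_right, star_smul, E.rinn_star]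

theorem rinn_rsmul_left (x y : Y) (d : D) : E.rinn (E.rsmul x d) y = star d * E.rinn x y := by
  rw [← E.rinn_star, E.rinn_rsmul_right, star_mul, E.rinn_star]

theorem norm_lsmul_le (c : C) (x : Y) : ‖E.lsmul c x‖ ≤ ‖c‖ * ‖x‖ := by
  have h : ‖E.lsmul c x‖ ^ 2 ≤ (‖c‖ * ‖x‖) ^ 2 := by
    rw [← E.norm_linn, E.linn_lsmul_left, E.linn_lsmul_right]
    calc _ ≤ ‖c‖ * (‖E.linn x x‖ * ‖star c‖) :=
          (norm_mul_le _ _).trans (by gcongr; exact norm_mul_le _ _)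
      _ = _ := by rw [E.norm_linn, norm_star]; ring
  exact le_of_sq_le_sq h (by positivity)

theorem norm_rsmul_le (x : Y) (d : D) : ‖E.rsmul x d‖ ≤ ‖x‖ * ‖d‖ := by
  have h : ‖E.rsmul x d‖ ^ 2 ≤ (‖x‖ * ‖d‖) ^ 2 := by
    rw [← E.norm_rinn, E.rinn_rsmul_right, E.rinn_rsmul_left]
    calc _ ≤ (‖star d‖ * ‖E.rinn x x‖) * ‖d‖ :=
          (norm_mul_le _ _).trans (by gcongr; exact norm_mul_le _ _)
      _ = _ := by rw [E.norm_rinn, norm_star]; ring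
  exact le_of_sq_le_sq h (by positivity)

/-- left action as a continuous linear map -/
def lsmulL (c : C) : Y →L[ℂ] Y :=
  LinearMap.mkContinuous ⟨⟨E.lsmul c, E.lsmul_add c⟩, fun z y => E.lsmul_smul z c y⟩ ‖c‖
    (E.norm_lsmul_le c)

/-- right action as a continuous linear map -/
def rsmulL (d : D) : Y →L[ℂ] Y :=
  LinearMap.mkContinuous ⟨⟨fun y => E.rsmul y d, fun x y => E.add_rsmul x y d⟩,
    fun z y => E.rsmul_smul z y d⟩ ‖d‖
    (fun y => (E.norm_rsmul_le y d).trans (mul_comm _ _).le)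

/-- left action in the algebra variable -/
def lactL (y : Y) : C →L[ℂ] Y :=
  LinearMap.mkContinuous ⟨⟨fun c => E.lsmul c y, fun c c' => E.add_lsmul c c' y⟩,
    fun z c => E.smul_lsmul z c y⟩ ‖y‖
    (fun c => (E.norm_lsmul_le c y).trans (mul_comm _ _).le)

/-- right action in the algebra variable -/
def ractL (y : Y) : D →L[ℂ] Y :=
  LinearMap.mkContinuous ⟨⟨fun d => E.rsmul y d, fun d d' => E.rsmul_add y d d'⟩,
    fun z d => E.smul_rsmul z y d⟩ ‖y‖
    (fun d => (E.norm_rsmul_le y d))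

theorem sesq_bound {V : Type*} [NormedAddCommGroup V] [NormedSpace ℂ V]
    (b : Y → Y → V) (h1 : ∀ x y z, b (x + y) z = b x z + b y z)
    (h2 : ∀ x y z, b x (y + z) = b x y + b x z)
    (h3 : ∀ (t : ℂ) x y, b (t • x) y = t • b x y)
    (h4 : ∀ (t : ℂ) x y, b x (t • y) = star t • b x y)
    (hn : ∀ x, ‖b x x‖ ≤ ‖x‖ ^ 2) (x y : Y) : ‖b x y‖ ≤ 4 * ‖x‖ * ‖y‖ := by
  have key : ∀ x y, ‖x‖ = 1 → ‖y‖ = 1 → ‖b x y‖ ≤ 4 := by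
    intro x y hx hy
    have pol : (4 : ℂ) • b x y = b (x + y) (x + y) - b (x + (-1 : ℂ) • y) (x + (-1 : ℂ) • y)
        + Complex.I • b (x + Complex.I • y) (x + Complex.I • y)
        - Complex.I • b (x + (-Complex.I) • y) (x + (-Complex.I) • y) := by
      simp only [h1, h2, h3, h4, smul_add, smul_smul]
      simp only [star_neg, RCLike.star_def, Complex.conj_I, map_one, neg_neg, mul_neg, neg_mul,
        Complex.I_mul_I, mul_one]
      module
    have e : ∀ z : ℂ, ‖z‖ = 1 → ‖b (x + z • y) (x + z • y)‖ ≤ 4 := by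
      intro z hz
      refine (hn _).trans ?_
      have : ‖x + z • y‖ ≤ 2 := (norm_add_le _ _).trans (by rw [norm_smul, hz, hx, hy]; norm_num)
      nlinarith [norm_nonneg (x + z • y)]
    have e1 := e 1 (by simp)
    have e2 := e (-1) (by simp)
    have e3 := e Complex.I (by simp)
    have e4 := e (-Complex.I) (by simp)
    rw [one_smul] at e1
    have : ‖(4 : ℂ) • b x y‖ ≤ 4 + 4 + 4 + 4 := by
      rw [pol]
      refine (norm_sub_le _ _).trans (add_le_add ((norm_add_le _ _).trans
        (add_le_add ((norm_sub_le _ _).trans (add_le_add e1 e2)) ?_)) ?_)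
      · rw [norm_smul]; simpa using e3
      · rw [norm_smul]; simpa using e4
    rw [norm_smul] at this
    norm_num at this
    linarith
  by_cases hx : x = 0
  · have := h3 0 x y
    simp only [zero_smul] at this
    rw [hx]
    simp [this]
  by_cases hy : y = 0
  · have := h4 0 x y
    simp only [zero_smul, star_zero] at this
    rw [hy]
    simp [this]
  have hx' : ‖x‖ ≠ 0 := norm_ne_zero_iff.2 hx
  have hy' : ‖y‖ ≠ 0 := norm_ne_zero_iff.2 hy
  have := key (((‖x‖⁻¹ : ℝ) : ℂ) • x) (((‖y‖⁻¹ : ℝ) : ℂ) • y)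
    (by rw [norm_smul]; simp [hx']) (by rw [norm_smul]; simp [hy'])
  rw [h3, h4, norm_smul, norm_smul, norm_star] at this
  simp only [Complex.norm_real, norm_inv, norm_norm] at this
  have h5 : ‖b x y‖ = ‖x‖ * ‖y‖ * (‖x‖⁻¹ * (‖y‖⁻¹ * ‖b x y‖)) := by field_simp
  rw [h5]
  calc _ ≤ ‖x‖ * ‖y‖ * 4 := by gcongr
    _ = _ := by ring

theorem norm_linn_le (x y : Y) : ‖E.linn x y‖ ≤ 4 * ‖x‖ * ‖y‖ :=
  sesq_bound E.linn E.linn_add_left E.linn_add_right E.linn_smul_left E.linn_smul_right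
    (fun x => (E.norm_linn x).le) x y

theorem norm_rinn_le (x y : Y) : ‖E.rinn x y‖ ≤ 4 * ‖x‖ * ‖y‖ := by
  have := sesq_bound (fun x y => E.rinn y x) (fun x y z => E.rinn_add_right z x y)
    (fun x y z => E.rinn_add_left y z x) (fun t x y => E.rinn_smul_right t y x)
    (fun t x y => E.rinn_smul_left t y x)
    (fun x => (E.norm_rinn x).le) y x
  exact this.trans (by ring_nf; rfl)

/-- left inner product, first variable -/
def linnL (y : Y) : Y →L[ℂ] C :=
  LinearMap.mkContinuous ⟨⟨fun x => E.linn x y, fun a b => E.linn_add_left a b y⟩,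
    fun z a => E.linn_smul_left z a y⟩ (4 * ‖y‖)
    (fun x => (E.norm_linn_le x y).trans (by ring_nf; rfl))

/-- right inner product, second variable -/
def rinnL (x : Y) : Y →L[ℂ] D :=
  LinearMap.mkContinuous ⟨⟨fun y => E.rinn x y, fun a b => E.rinn_add_right x a b⟩,
    fun z a => E.rinn_smul_right z x a⟩ (4 * ‖x‖)
    (fun y => (E.norm_rinn_le x y))

theorem lsmulL_apply (c : C) (y : Y) : E.lsmulL c y = E.lsmul c y := rfl
theorem rsmulL_apply (d : D) (y : Y) : E.rsmulL d y = E.rsmul y d := rfl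
theorem lactL_apply (c : C) (y : Y) : E.lactL y c = E.lsmul c y := rfl
theorem ractL_apply (d : D) (y : Y) : E.ractL y d = E.rsmul y d := rfl
theorem linnL_apply (x y : Y) : E.linnL y x = E.linn x y := rfl
theorem rinnL_apply (x y : Y) : E.rinnL x y = E.rinn x y := rfl

theorem continuous_linn_left (y : Y) : Continuous fun x => E.linn x y := (E.linnL y).continuous
theorem continuous_rinn_right (x : Y) : Continuous fun y => E.rinn x y := (E.rinnL x).continuous
theorem continuous_linn_right (x : Y) : Continuous fun y => E.linn x y := by
  have : (fun y => E.linn x y) = fun y => star (E.linn y x) := by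
    funext y; rw [E.linn_star]
  rw [this]; exact continuous_star.comp (E.continuous_linn_left x)
theorem continuous_rinn_left (y : Y) : Continuous fun x => E.rinn x y := by
  have : (fun x => E.rinn x y) = fun x => star (E.rinn y x) := by
    funext x; rw [E.rinn_star]
  rw [this]; exact continuous_star.comp (E.continuous_rinn_right y)
theorem continuous_lsmul (c : C) : Continuous fun x => E.lsmul c x := (E.lsmulL c).continuous
theorem continuous_rsmul (d : D) : Continuous fun x => E.rsmul x d := (E.rsmulL d).continuous

theorem lsmul_sum {κ : Type*} (s : Finset κ) (c : C) (f : κ → Y) :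
    E.lsmul c (∑ i ∈ s, f i) = ∑ i ∈ s, E.lsmul c (f i) := map_sum (E.lsmulL c) f s
theorem sum_lsmul {κ : Type*} (s : Finset κ) (f : κ → C) (y : Y) :
    E.lsmul (∑ i ∈ s, f i) y = ∑ i ∈ s, E.lsmul (f i) y := map_sum (E.lactL y) f s
theorem sum_rsmul {κ : Type*} (s : Finset κ) (f : κ → Y) (d : D) :
    E.rsmul (∑ i ∈ s, f i) d = ∑ i ∈ s, E.rsmul (f i) d := map_sum (E.rsmulL d) f s
theorem rsmul_sum {κ : Type*} (s : Finset κ) (y : Y) (f : κ → D) :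
    E.rsmul y (∑ i ∈ s, f i) = ∑ i ∈ s, E.rsmul y (f i) := map_sum (E.ractL y) f s
theorem linn_sum_left {κ : Type*} (s : Finset κ) (f : κ → Y) (y : Y) :
    E.linn (∑ i ∈ s, f i) y = ∑ i ∈ s, E.linn (f i) y := map_sum (E.linnL y) f s
theorem linn_sum_right {κ : Type*} (s : Finset κ) (f : κ → Y) (y : Y) :
    E.linn y (∑ i ∈ s, f i) = ∑ i ∈ s, E.linn y (f i) := by
  rw [← E.linn_star, E.linn_sum_left, star_sum]
  simp only [E.linn_star]
theorem rinn_sum_right {κ : Type*} (s : Finset κ) (f : κ → Y) (y : Y) :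
    E.rinn y (∑ i ∈ s, f i) = ∑ i ∈ s, E.rinn y (f i) := map_sum (E.rinnL y) f s
theorem rinn_sum_left {κ : Type*} (s : Finset κ) (f : κ → Y) (y : Y) :
    E.rinn (∑ i ∈ s, f i) y = ∑ i ∈ s, E.rinn (f i) y := by
  rw [← E.rinn_star, E.rinn_sum_right, star_sum]
  simp only [E.rinn_star]
theorem linn_sub_left (x x' y : Y) : E.linn (x - x') y = E.linn x y - E.linn x' y :=
  map_sub (E.linnL y) x x'
theorem linn_sub_right (x y y' : Y) : E.linn x (y - y') = E.linn x y - E.linn x y' := by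
  rw [← E.linn_star, E.linn_sub_left, star_sub, E.linn_star, E.linn_star]
theorem rinn_sub_right (x y y' : Y) : E.rinn x (y - y') = E.rinn x y - E.rinn x y' :=
  map_sub (E.rinnL x) y y'
theorem rinn_sub_left (x x' y : Y) : E.rinn (x - x') y = E.rinn x y - E.rinn x' y := by
  rw [← E.rinn_star, E.rinn_sub_right, star_sub, E.rinn_star, E.rinn_star]
theorem linn_zero_left (y : Y) : E.linn 0 y = 0 := map_zero (E.linnL y)
theorem rinn_zero_right (y : Y) : E.rinn y 0 = 0 := map_zero (E.rinnL y)
theorem linn_zero_right (y : Y) : E.linn y 0 = 0 := by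
  rw [← E.linn_star, E.linn_zero_left, star_zero]
theorem rinn_zero_left (y : Y) : E.rinn 0 y = 0 := by
  rw [← E.rinn_star, E.rinn_zero_right, star_zero]
theorem lsmul_zero (c : C) : E.lsmul c 0 = 0 := map_zero (E.lsmulL c)
theorem zero_lsmul (y : Y) : E.lsmul 0 y = 0 := map_zero (E.lactL y)
theorem zero_rsmul (d : D) : E.rsmul 0 d = 0 := map_zero (E.rsmulL d)
theorem rsmul_zero (y : Y) : E.rsmul y 0 = 0 := map_zero (E.ractL y)

theorem linn_rsmul_left (x y : Y) (d : D) :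
    E.linn (E.rsmul x d) y = E.linn x (E.rsmul y (star d)) := by
  have hcl : IsClosed {d : D | E.linn (E.rsmul x d) y = E.linn x (E.rsmul y (star d))} :=
    isClosed_eq ((E.continuous_linn_left y).comp (E.ractL x).continuous)
      ((E.continuous_linn_right x).comp ((E.ractL y).continuous.comp continuous_star))
  refine E.full_right.induction (P := fun d =>
    E.linn (E.rsmul x d) y = E.linn x (E.rsmul y (star d))) ?_ hcl d
  intro d hd
  induction hd using Submodule.span_induction with
  | mem d h =>
    obtain ⟨a, b, rfl⟩ := h
    rw [← E.imprimitivity, E.rinn_star, ← E.imprimitivity, E.linn_lsmul_left,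
      E.linn_lsmul_right, E.linn_star]
  | zero => simp only [E.rsmul_zero, star_zero, E.linn_zero_left, E.linn_zero_right]
  | add a b _ _ ha hb =>
    simp only [E.rsmul_add, star_add, E.linn_add_left, E.linn_add_right, ha, hb]
  | smul z a _ ha =>
    simp only [E.smul_rsmul, star_smul, E.linn_smul_left, E.linn_smul_right, ha, star_star]

theorem rinn_lsmul_left (x y : Y) (c : C) :
    E.rinn (E.lsmul c x) y = E.rinn x (E.lsmul (star c) y) := by
  have hcl : IsClosed {c : C | E.rinn (E.lsmul c x) y = E.rinn x (E.lsmul (star c) y)} :=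
    isClosed_eq ((E.continuous_rinn_left y).comp (E.lactL x).continuous)
      ((E.continuous_rinn_right x).comp ((E.lactL y).continuous.comp continuous_star))
  refine E.full_left.induction (P := fun c =>
    E.rinn (E.lsmul c x) y = E.rinn x (E.lsmul (star c) y)) ?_ hcl c
  intro d hd
  induction hd using Submodule.span_induction with
  | mem d h =>
    obtain ⟨a, b, rfl⟩ := h
    rw [E.imprimitivity, E.linn_star, E.imprimitivity, E.rinn_rsmul_left,
      E.rinn_rsmul_right, E.rinn_star]
  | zero => simp only [E.zero_lsmul, star_zero, E.rinn_zero_left, E.rinn_zero_right]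
  | add a b _ _ ha hb =>
    simp only [E.add_lsmul, star_add, E.rinn_add_left, E.rinn_add_right, ha, hb]
  | smul z a _ ha =>
    simp only [E.smul_lsmul, star_smul, E.rinn_smul_left, E.rinn_smul_right, ha]

end Basic

section Unit

variable {C D Y : Type*}
    [CStarAlgebra C] [PartialOrder C] [StarOrderedRing C]
    [CStarAlgebra D] [PartialOrder D] [StarOrderedRing D]
    [NormedAddCommGroup Y] [NormedSpace ℂ Y] [CompleteSpace Y]
    (E : EquivBimodule C D Y)

theorem one_lsmul (y : Y) : E.lsmul 1 y = y := by
  rw [← sub_eq_zero]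
  apply E.linn_definite
  rw [E.linn_sub_left, E.linn_lsmul_left, one_mul, sub_self]

theorem rsmul_one (y : Y) : E.rsmul y 1 = y := by
  rw [← sub_eq_zero]
  apply E.rinn_definite
  rw [E.rinn_sub_right, E.rinn_rsmul_right, mul_one, sub_self]

end Unit

end EquivBimodule

section UniqueUpward

variable {A C C₁ : Type*} [CStarAlgebra A] [CStarAlgebra C] [CStarAlgebra C₁]
  [PartialOrder A] [StarOrderedRing A]
  [PartialOrder C] [StarOrderedRing C]
  [PartialOrder C₁] [StarOrderedRing C₁]
  {Xc T V : Type*}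
  [NormedAddCommGroup Xc] [NormedSpace ℂ Xc] [CompleteSpace Xc]
  [NormedAddCommGroup T] [NormedSpace ℂ T] [CompleteSpace T]
  [NormedAddCommGroup V] [NormedSpace ℂ V] [CompleteSpace V]
  {ι : A →⋆ₐ[ℂ] C} {EA : CondExpectation ι} {M : EquivBimodule A A Xc}
  {ιC : C →⋆ₐ[ℂ] C₁} {eA : C₁}
  {F : EquivBimodule C₁ C₁ T} {t : C → Xc → C → T}
  {G : EquivBimodule C₁ C₁ V} {s : C → Xc → C → V}

/-- linear combinations of elementary tensors -/
def combL (t : C → Xc → C → T) : (C × Xc × C →₀ ℂ) →ₗ[ℂ] T :=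
  Finsupp.linearCombination ℂ (fun p : C × Xc × C => t p.1 p.2.1 p.2.2)

theorem combL_single (t : C → Xc → C → T) (p : C × Xc × C) (z : ℂ) :
    combL t (Finsupp.single p z) = z • t p.1 p.2.1 p.2.2 := by
  simp [combL]

theorem IsUpwardBasic.denseRange (h : IsUpwardBasic ι ι EA EA M ιC eA ιC eA F t) :
    DenseRange (combL t) := by
  have := h.dense
  have e : {v : T | ∃ c x d, v = t c x d} =
      Set.range (fun p : C × Xc × C => t p.1 p.2.1 p.2.2) := by
    ext v
    constructor
    · rintro ⟨c, x, d, rfl⟩; exact ⟨(c, x, d), rfl⟩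
    · rintro ⟨p, rfl⟩; exact ⟨_, _, _, rfl⟩
  rw [e, ← Finsupp.range_linearCombination] at this
  exact this

theorem IsUpwardBasic.induction (h : IsUpwardBasic ι ι EA EA M ιC eA ιC eA F t)
    {f g : T →L[ℂ] V} (hfg : ∀ c x d, f (t c x d) = g (t c x d)) (v : T) : f v = g v := by
  refine h.denseRange.induction_on (p := fun v => f v = g v) v
    (isClosed_eq f.continuous g.continuous) ?_
  intro a
  induction a using Finsupp.induction_linear with
  | zero => simp
  | add a b ha hb => simp only [map_add, ha, hb]
  | single p z => simp only [combL_single, map_smul, hfg]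

theorem combL_linn (h : IsUpwardBasic ι ι EA EA M ιC eA ιC eA F t)
    (k : IsUpwardBasic ι ι EA EA M ιC eA ιC eA G s) (a b : C × Xc × C →₀ ℂ) :
    G.linn (combL s a) (combL s b) = F.linn (combL t a) (combL t b) := by
  induction a using Finsupp.induction_linear with
  | zero => simp only [map_zero, EquivBimodule.linn_zero_left]
  | add a b ha hb => simp only [map_add, EquivBimodule.linn_add_left, ha, hb]
  | single p z =>
    induction b using Finsupp.induction_linear with
    | zero => simp only [map_zero, EquivBimodule.linn_zero_right]
    | add a b ha hb => simp only [map_add, EquivBimodule.linn_add_right, ha, hb]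
    | single q z' =>
      simp only [combL_single, EquivBimodule.linn_smul_left, EquivBimodule.linn_smul_right,
        h.linn_eq, k.linn_eq]

theorem combL_rinn (h : IsUpwardBasic ι ι EA EA M ιC eA ιC eA F t)
    (k : IsUpwardBasic ι ι EA EA M ιC eA ιC eA G s) (a b : C × Xc × C →₀ ℂ) :
    G.rinn (combL s a) (combL s b) = F.rinn (combL t a) (combL t b) := by
  induction a using Finsupp.induction_linear with
  | zero => simp only [map_zero, EquivBimodule.rinn_zero_left]
  | add a b ha hb => simp only [map_add, EquivBimodule.rinn_add_left, ha, hb]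
  | single p z =>
    induction b using Finsupp.induction_linear with
    | zero => simp only [map_zero, EquivBimodule.rinn_zero_right]
    | add a b ha hb => simp only [map_add, EquivBimodule.rinn_add_right, ha, hb]
    | single q z' =>
      simp only [combL_single, EquivBimodule.rinn_smul_left, EquivBimodule.rinn_smul_right,
        h.rinn_eq, k.rinn_eq]

theorem combL_norm (h : IsUpwardBasic ι ι EA EA M ιC eA ιC eA F t)
    (k : IsUpwardBasic ι ι EA EA M ιC eA ιC eA G s) (a : C × Xc × C →₀ ℂ) :
    ‖combL s a‖ = ‖combL t a‖ := by
  have : ‖combL s a‖ ^ 2 = ‖combL t a‖ ^ 2 := by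
    rw [← F.norm_linn, ← G.norm_linn, combL_linn h k]
  exact (sq_eq_sq₀ (norm_nonneg _) (norm_nonneg _)).1 this

theorem upward_unique (hbc : IsBasicConstruction ι EA ιC eA)
    (h : IsUpwardBasic ι ι EA EA M ιC eA ιC eA F t)
    (k : IsUpwardBasic ι ι EA EA M ιC eA ιC eA G s) :
    ∃ (Ψ : T ≃ₗᵢ[ℂ] V) (Φ : F.Iso G), Φ.toEquiv = Ψ.toLinearEquiv ∧
      ∀ c x d, Ψ (t c x d) = s c x d := by
  let Ψ : T ≃ₗᵢ[ℂ] V := LinearEquiv.extendOfIsometry (LinearEquiv.refl ℂ (C × Xc × C →₀ ℂ))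
    (combL t) (combL s) h.denseRange k.denseRange (fun a => combL_norm h k a)
  have hΨ : ∀ a, Ψ (combL t a) = combL s a := fun a =>
    LinearMap.extendOfNorm_eq (f := combL s) h.denseRange
      ⟨1, fun a => by rw [one_mul]; exact (combL_norm h k a).le⟩ a
  have hΨt : ∀ c x d, Ψ (t c x d) = s c x d := fun c x d => by
    have := hΨ (Finsupp.single (c, x, d) 1)
    simpa only [combL_single, one_smul] using this
  let Ψc : T →L[ℂ] V := Ψ.toContinuousLinearEquiv
  have hΨc : ∀ c x d, Ψc (t c x d) = s c x d := hΨt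
  have hl1 : ∀ c v, Ψ (F.lsmul (ιC c) v) = G.lsmul (ιC c) (Ψ v) := fun c v =>
    h.induction (f := Ψc.comp (F.lsmulL (ιC c))) (g := (G.lsmulL (ιC c)).comp Ψc)
      (fun c x d => by
        simp only [ContinuousLinearMap.comp_apply, EquivBimodule.lsmulL_apply, h.map_lsmul, hΨc,
          k.map_lsmul]) v
  have hl2 : ∀ v, Ψ (F.lsmul eA v) = G.lsmul eA (Ψ v) := fun v =>
    h.induction (f := Ψc.comp (F.lsmulL eA)) (g := (G.lsmulL eA).comp Ψc)
      (fun c x d => by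
        simp only [ContinuousLinearMap.comp_apply, EquivBimodule.lsmulL_apply, h.map_eA, hΨc,
          k.map_eA]) v
  have hr1 : ∀ c v, Ψ (F.rsmul v (ιC c)) = G.rsmul (Ψ v) (ιC c) := fun c v =>
    h.induction (f := Ψc.comp (F.rsmulL (ιC c))) (g := (G.rsmulL (ιC c)).comp Ψc)
      (fun c x d => by
        simp only [ContinuousLinearMap.comp_apply, EquivBimodule.rsmulL_apply, h.map_rsmul, hΨc,
          k.map_rsmul]) v
  have hr2 : ∀ v, Ψ (F.rsmul v eA) = G.rsmul (Ψ v) eA := fun v =>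
    h.induction (f := Ψc.comp (F.rsmulL eA)) (g := (G.rsmulL eA).comp Ψc)
      (fun c x d => by
        simp only [ContinuousLinearMap.comp_apply, EquivBimodule.rsmulL_apply, h.map_eB, hΨc,
          k.map_eB]) v
  refine ⟨Ψ, ⟨Ψ.toLinearEquiv, ?_, ?_, ?_, ?_⟩, rfl, hΨt⟩
  · intro c y
    change Ψ _ = G.lsmul c (Ψ y)
    induction hbc.span c using Submodule.span_induction with
    | mem d h =>
      obtain ⟨a, b, rfl⟩ := h
      simp only [EquivBimodule.mul_lsmul, hl1, hl2]
    | zero => simp only [EquivBimodule.zero_lsmul, map_zero]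
    | add a b _ _ ha hb => simp only [EquivBimodule.add_lsmul, map_add, ha, hb]
    | smul z a _ ha => simp only [EquivBimodule.smul_lsmul, map_smul, ha]
  · intro y c
    change Ψ _ = G.rsmul (Ψ y) c
    induction hbc.span c using Submodule.span_induction with
    | mem d h =>
      obtain ⟨a, b, rfl⟩ := h
      simp only [EquivBimodule.rsmul_mul, hr1, hr2]
    | zero => simp only [EquivBimodule.rsmul_zero, map_zero]
    | add a b _ _ ha hb => simp only [EquivBimodule.rsmul_add, map_add, ha, hb]
    | smul z a _ ha => simp only [EquivBimodule.smul_rsmul, map_smul, ha]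
  · intro x y
    change G.linn (Ψ x) (Ψ y) = _
    refine h.denseRange.induction_on (p := fun x => G.linn (Ψ x) (Ψ y) = F.linn x y) x
      (isClosed_eq ((G.continuous_linn_left _).comp Ψ.continuous) (F.continuous_linn_left _)) ?_
    intro a
    refine h.denseRange.induction_on
      (p := fun y => G.linn (Ψ (combL t a)) (Ψ y) = F.linn (combL t a) y) y
      (isClosed_eq ((G.continuous_linn_right _).comp Ψ.continuous)
        (F.continuous_linn_right _)) ?_
    intro b
    rw [hΨ, hΨ, combL_linn h k]
  · intro x y
    change G.rinn (Ψ x) (Ψ y) = _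
    refine h.denseRange.induction_on (p := fun x => G.rinn (Ψ x) (Ψ y) = F.rinn x y) x
      (isClosed_eq ((G.continuous_rinn_left _).comp Ψ.continuous) (F.continuous_rinn_left _)) ?_
    intro a
    refine h.denseRange.induction_on
      (p := fun y => G.rinn (Ψ (combL t a)) (Ψ y) = F.rinn (combL t a) y) y
      (isClosed_eq ((G.continuous_rinn_right _).comp Ψ.continuous)
        (F.continuous_rinn_right _)) ?_
    intro b
    rw [hΨ, hΨ, combL_rinn h k]

end UniqueUpward

section Level

variable {A C C₁ : Type*} [CStarAlgebra A] [CStarAlgebra C] [CStarAlgebra C₁]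
  [PartialOrder A] [StarOrderedRing A]
  [PartialOrder C] [StarOrderedRing C]
  [PartialOrder C₁] [StarOrderedRing C₁]
  {Y T : Type*}
  [NormedAddCommGroup Y] [NormedSpace ℂ Y] [CompleteSpace Y]
  [NormedAddCommGroup T] [NormedSpace ℂ T] [CompleteSpace T]

theorem IsBasicConstruction.sum_one {ι : A →⋆ₐ[ℂ] C} {EA : CondExpectation ι}
    {ιC : C →⋆ₐ[ℂ] C₁} {eA : C₁} (hbc : IsBasicConstruction ι EA ιC eA)
    {n : ℕ} {u : Fin n → C} (hu : IsQuasiBasis EA u) :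
    ∑ i, ιC (u i) * eA * ιC (star (u i)) = 1 := by
  have key : ∀ x : C₁, (∑ i, ιC (u i) * eA * ιC (star (u i))) * x = x := by
    intro x
    induction hbc.span x using Submodule.span_induction with
    | mem d h =>
      obtain ⟨a, b, rfl⟩ := h
      have : ∀ i, ιC (u i) * eA * ιC (star (u i)) * (ιC a * eA * ιC b) =
          ιC (u i * ι (EA.toFun (star (u i) * a))) * (eA * ιC b) := by
        intro i
        have h1 := hbc.expect (star (u i) * a)
        rw [map_mul] at h1
        calc _ = ιC (u i) * (eA * (ιC (star (u i)) * ιC a) * eA) * ιC b := by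
              simp only [mul_assoc]
          _ = _ := by rw [h1, map_mul]; simp only [mul_assoc]
      rw [Finset.sum_mul]
      simp only [this]
      rw [← Finset.sum_mul, ← map_sum, (hu a).1, mul_assoc]
    | zero => simp
    | add a b _ _ ha hb => rw [mul_add, ha, hb]
    | smul z a _ ha => rw [mul_smul_comm, ha]
  simpa using key 1

/-- All the data around one upward basic construction. -/
structure Lvl (ι : A →⋆ₐ[ℂ] C) (EA : CondExpectation ι) {n : ℕ} (u : Fin n → C)
    (ιC : C →⋆ₐ[ℂ] C₁) (eA : C₁) (EY : EquivBimodule C C Y) (X : Submodule ℂ Y)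
    [CompleteSpace X] (MX : EquivBimodule A A X) (P : Y → X)
    (F : EquivBimodule C₁ C₁ T) (t : C → X → C → T) : Prop where
  hu : IsQuasiBasis EA u
  hbc : IsBasicConstruction ι EA ιC eA
  hMX : IsRestriction ι ι EY X MX
  hEX : IsBimodCondExp ι ι EA EA EY X (fun y => (P y : Y))
  hup : IsUpwardBasic ι ι EA EA MX ιC eA ιC eA F t
  ndl : ∀ v : Y, (∀ x ∈ X, EY.linn v x = 0) → v = 0
  ndr : ∀ v : Y, (∀ x ∈ X, EY.rinn x v = 0) → v = 0

/-- The embedding `φ_Y` of `Y` in `Y₁`. -/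
def phiMap {n : ℕ} (u : Fin n → C) (EY : EquivBimodule C C Y) {X : Submodule ℂ Y} (P : Y → X)
    (t : C → X → C → T) (y : Y) : T :=
  ∑ i, ∑ j, t (u i) (P (EY.lsmul (star (u i)) (EY.rsmul y (u j)))) (u j)

namespace IsUpwardBasic

variable {Xc : Type*} [NormedAddCommGroup Xc] [NormedSpace ℂ Xc] [CompleteSpace Xc]
  {ι : A →⋆ₐ[ℂ] C} {EA : CondExpectation ι} {M : EquivBimodule A A Xc}
  {ιC : C →⋆ₐ[ℂ] C₁} {eA : C₁}
  {F : EquivBimodule C₁ C₁ T} {t : C → Xc → C → T}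

theorem sum₁ (h : IsUpwardBasic ι ι EA EA M ιC eA ιC eA F t) {κ : Type*} (s : Finset κ)
    (f : κ → C) (x : Xc) (d : C) : t (∑ i ∈ s, f i) x d = ∑ i ∈ s, t (f i) x d :=
  map_sum (AddMonoidHom.mk' (fun c => t c x d) (fun c c' => h.add₁ c c' x d)) f s

theorem sum₂ (h : IsUpwardBasic ι ι EA EA M ιC eA ιC eA F t) {κ : Type*} (s : Finset κ)
    (c : C) (f : κ → Xc) (d : C) : t c (∑ i ∈ s, f i) d = ∑ i ∈ s, t c (f i) d :=
  map_sum (AddMonoidHom.mk' (fun x => t c x d) (fun x x' => h.add₂ c x x' d)) f s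

theorem sum₃ (h : IsUpwardBasic ι ι EA EA M ιC eA ιC eA F t) {κ : Type*} (s : Finset κ)
    (c : C) (x : Xc) (f : κ → C) : t c x (∑ i ∈ s, f i) = ∑ i ∈ s, t c x (f i) :=
  map_sum (AddMonoidHom.mk' (fun d => t c x d) (fun d d' => h.add₃ c x d d')) f s

end IsUpwardBasic

namespace Lvl

variable {ι : A →⋆ₐ[ℂ] C} {EA : CondExpectation ι} {n : ℕ} {u : Fin n → C}
    {ιC : C →⋆ₐ[ℂ] C₁} {eA : C₁} {EY : EquivBimodule C C Y} {X : Submodule ℂ Y}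
    [CompleteSpace X] {MX : EquivBimodule A A X} {P : Y → X}
    {F : EquivBimodule C₁ C₁ T} {t : C → X → C → T}

theorem P_add (h : Lvl ι EA u ιC eA EY X MX P F t) (y y' : Y) : P (y + y') = P y + P y' :=
  Subtype.ext (h.hEX.map_add y y')

theorem P_smul (h : Lvl ι EA u ιC eA EY X MX P F t) (z : ℂ) (y : Y) : P (z • y) = z • P y :=
  Subtype.ext (h.hEX.map_smul z y)

theorem P_sum (h : Lvl ι EA u ιC eA EY X MX P F t) {κ : Type*} (s : Finset κ) (f : κ → Y) :
    P (∑ i ∈ s, f i) = ∑ i ∈ s, P (f i) :=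
  map_sum (AddMonoidHom.mk' P h.P_add) f s

theorem P_lsmul (h : Lvl ι EA u ιC eA EY X MX P F t) (a : A) (y : Y) :
    P (EY.lsmul (ι a) y) = MX.lsmul a (P y) :=
  Subtype.ext ((h.hEX.cond2 a y).trans (h.hMX.lsmul_coe _ _).symm)

theorem P_rsmul (h : Lvl ι EA u ιC eA EY X MX P F t) (a : A) (y : Y) :
    P (EY.rsmul y (ι a)) = MX.rsmul (P y) a :=
  Subtype.ext ((h.hEX.cond5 a y).trans (h.hMX.rsmul_coe _ _).symm)

theorem P_rsmul_mem (h : Lvl ι EA u ιC eA EY X MX P F t) (c : C) (x : X) :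
    P (EY.rsmul x c) = MX.rsmul x (EA.toFun c) :=
  Subtype.ext ((h.hEX.cond4 c x x.2).trans (h.hMX.rsmul_coe _ _).symm)

theorem P_lsmul_mem (h : Lvl ι EA u ιC eA EY X MX P F t) (c : C) (x : X) :
    P (EY.lsmul c x) = MX.lsmul (EA.toFun c) x :=
  Subtype.ext ((h.hEX.cond1 c x x.2).trans (h.hMX.lsmul_coe _ _).symm)

theorem linn_P (h : Lvl ι EA u ιC eA EY X MX P F t) (y : Y) (x : X) :
    EY.linn (P y) x = ι (EA.toFun (EY.linn y x)) := (h.hEX.cond3 y x x.2).symm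

theorem rinn_P (h : Lvl ι EA u ιC eA EY X MX P F t) (y : Y) (x : X) :
    EY.rinn x (P y) = ι (EA.toFun (EY.rinn x y)) := by
  rw [← EY.rinn_star, ← h.hEX.cond6 y x x.2, ← map_star, ← EA.map_star, EY.rinn_star]

theorem expand_right (h : Lvl ι EA u ιC eA EY X MX P F t) (z : Y) :
    ∑ l, EY.rsmul (P (EY.rsmul z (u l)) : Y) (star (u l)) = z := by
  rw [← sub_eq_zero]
  apply h.ndr
  intro x hx
  rw [EY.rinn_sub_right, EY.rinn_sum_right]
  simp only [EY.rinn_rsmul_right]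
  have : ∀ l, EY.rinn x (P (EY.rsmul z (u l))) = ι (EA.toFun (EY.rinn x z * u l)) := by
    intro l
    rw [h.rinn_P _ ⟨x, hx⟩, EY.rinn_rsmul_right]
  simp only [this]
  rw [(h.hu _).2, sub_self]

theorem expand_left (h : Lvl ι EA u ιC eA EY X MX P F t) (z : Y) :
    ∑ l, EY.lsmul (u l) (P (EY.lsmul (star (u l)) z) : Y) = z := by
  rw [← sub_eq_zero]
  apply h.ndl
  intro x hx
  rw [EY.linn_sub_left, EY.linn_sum_left]
  simp only [EY.linn_lsmul_left]
  have : ∀ l, EY.linn (P (EY.lsmul (star (u l)) z)) x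
      = ι (EA.toFun (star (u l) * EY.linn z x)) := by
    intro l
    rw [h.linn_P _ ⟨x, hx⟩, EY.linn_lsmul_left]
  simp only [this]
  rw [(h.hu _).1, sub_self]

theorem phi_add (h : Lvl ι EA u ιC eA EY X MX P F t) (y y' : Y) :
    phiMap u EY P t (y + y') = phiMap u EY P t y + phiMap u EY P t y' := by
  simp only [phiMap, EY.add_rsmul, EY.lsmul_add, h.P_add, h.hup.add₂, Finset.sum_add_distrib]

theorem phi_smul (h : Lvl ι EA u ιC eA EY X MX P F t) (z : ℂ) (y : Y) :
    phiMap u EY P t (z • y) = z • phiMap u EY P t y := by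
  simp only [phiMap, EY.rsmul_smul, EY.lsmul_smul, h.P_smul, h.hup.smul₂, Finset.smul_sum]

theorem phi_linn (h : Lvl ι EA u ιC eA EY X MX P F t) (y y' : Y) :
    F.linn (phiMap u EY P t y) (phiMap u EY P t y') = ιC (EY.linn y y') := by
  have s1 : ∀ k l, F.linn (phiMap u EY P t y)
      (t (u k) (P (EY.lsmul (star (u k)) (EY.rsmul y' (u l)))) (u l)) =
      ιC (EY.linn y (EY.rsmul (P (EY.rsmul (EY.lsmul (star (u k)) y') (u l))) (star (u l))))
        * eA * ιC (star (u k)) := by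
    intro k l
    rw [EY.lsmul_rsmul]
    generalize P (EY.lsmul (star (u k)) (EY.rsmul y' (u l))) = x'
    simp only [phiMap, F.linn_sum_left, h.hup.linn_eq]
    simp only [← Finset.sum_mul, ← map_sum, ← Finset.mul_sum]
    have e1 : ∀ i, ∑ j, MX.linn (MX.rsmul (P (EY.lsmul (star (u i)) (EY.rsmul y (u j))))
        (EA.toFun (star (u j) * u l))) x' =
        MX.linn (P (EY.lsmul (star (u i)) (EY.rsmul y (u l)))) x' := by
      intro i
      rw [← MX.linn_sum_left]
      simp only [← h.P_rsmul, EY.lsmul_rsmul, ← EY.rsmul_mul]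
      rw [← h.P_sum, ← EY.lsmul_sum, ← EY.rsmul_sum, (h.hu _).1]
    simp only [e1, h.hMX.linn_coe, h.linn_P, EY.linn_lsmul_left]
    rw [(h.hu _).1, EY.linn_rsmul_left]
  conv_lhs => rw [phiMap.eq_def u EY P t y']
  simp only [F.linn_sum_right, s1]
  simp only [← Finset.sum_mul, ← map_sum, ← EY.linn_sum_right, h.expand_right]
  simp only [EY.linn_lsmul_right, star_star, map_mul, mul_assoc]
  rw [← Finset.mul_sum]
  have := h.hbc.sum_one h.hu
  simp only [mul_assoc] at this
  rw [this, mul_one]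

theorem phi_rinn (h : Lvl ι EA u ιC eA EY X MX P F t) (y y' : Y) :
    F.rinn (phiMap u EY P t y) (phiMap u EY P t y') = ιC (EY.rinn y y') := by
  have s1 : ∀ i j, F.rinn
      (t (u i) (P (EY.lsmul (star (u i)) (EY.rsmul y (u j)))) (u j)) (phiMap u EY P t y') =
      ιC (u j) * eA * ιC (EY.rinn
        (EY.lsmul (u i) (P (EY.lsmul (star (u i)) (EY.rsmul y (u j))))) y') := by
    intro i j
    generalize P (EY.lsmul (star (u i)) (EY.rsmul y (u j))) = x'
    simp only [phiMap, F.rinn_sum_right, h.hup.rinn_eq]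
    rw [Finset.sum_comm]
    simp only [← Finset.sum_mul, ← map_sum, ← Finset.mul_sum]
    have e1 : ∀ l, ∑ k, MX.rinn x' (MX.lsmul (EA.toFun (star (u i) * u k))
        (P (EY.lsmul (star (u k)) (EY.rsmul y' (u l))))) =
        MX.rinn x' (P (EY.rsmul (EY.lsmul (star (u i)) y') (u l))) := by
      intro l
      rw [← MX.rinn_sum_right]
      simp only [← h.P_lsmul, ← EY.mul_lsmul]
      rw [← h.P_sum, ← EY.sum_lsmul, (h.hu _).2, EY.lsmul_rsmul]
    simp only [e1, h.hMX.rinn_coe, h.rinn_P, EY.rinn_rsmul_right]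
    rw [(h.hu _).2, EY.rinn_lsmul_left]
  conv_lhs => rw [phiMap.eq_def u EY P t y]
  simp only [F.rinn_sum_left, s1]
  rw [Finset.sum_comm]
  simp only [← Finset.mul_sum, ← map_sum, ← EY.rinn_sum_left, h.expand_left]
  simp only [EY.rinn_rsmul_left, map_mul, ← mul_assoc]
  rw [← Finset.sum_mul]
  rw [h.hbc.sum_one h.hu, one_mul]

theorem phi_lsmul (h : Lvl ι EA u ιC eA EY X MX P F t) (c : C) (y : Y) :
    phiMap u EY P t (EY.lsmul c y) = F.lsmul (ιC c) (phiMap u EY P t y) := by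
  rw [← sub_eq_zero]
  apply F.linn_definite
  simp only [F.linn_sub_left, F.linn_sub_right, F.linn_lsmul_left, F.linn_lsmul_right,
    h.phi_linn, EY.linn_lsmul_left, EY.linn_lsmul_right, map_mul, map_star, mul_assoc, sub_self]

theorem phi_rsmul (h : Lvl ι EA u ιC eA EY X MX P F t) (c : C) (y : Y) :
    phiMap u EY P t (EY.rsmul y c) = F.rsmul (phiMap u EY P t y) (ιC c) := by
  rw [← sub_eq_zero]
  apply F.rinn_definite
  simp only [F.rinn_sub_left, F.rinn_sub_right, F.rinn_rsmul_left, F.rinn_rsmul_right,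
    h.phi_rinn, EY.rinn_rsmul_left, EY.rinn_rsmul_right, map_mul, map_star, mul_assoc, sub_self]

theorem phi_norm (h : Lvl ι EA u ιC eA EY X MX P F t) (y : Y) :
    ‖phiMap u EY P t y‖ = ‖y‖ := by
  have : ‖phiMap u EY P t y‖ ^ 2 = ‖y‖ ^ 2 := by
    rw [← F.norm_linn, h.phi_linn, ← EY.norm_linn,
      NonUnitalStarAlgHom.norm_map ιC h.hbc.inj]
  exact (sq_eq_sq₀ (norm_nonneg _) (norm_nonneg _)).1 this

/-- `φ_Y` as a linear isometry -/
def phiL (h : Lvl ι EA u ιC eA EY X MX P F t) : Y →ₗᵢ[ℂ] T where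
  toFun := phiMap u EY P t
  map_add' := h.phi_add
  map_smul' := h.phi_smul
  norm_map' := h.phi_norm

theorem phiL_apply (h : Lvl ι EA u ιC eA EY X MX P F t) (y : Y) :
    h.phiL y = phiMap u EY P t y := rfl

theorem quasi_one (h : Lvl ι EA u ιC eA EY X MX P F t) :
    ∑ i, u i * ι (star (EA.toFun (u i))) = 1 := by
  simpa only [mul_one, EA.map_star] using (h.hu 1).1

theorem e_phi (h : Lvl ι EA u ιC eA EY X MX P F t) (x : X) :
    F.lsmul eA (phiMap u EY P t x) = t 1 x 1 := by
  simp only [phiMap, F.lsmul_sum, h.hup.map_eA]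
  have e1 : ∀ i j, t (ι (EA.toFun (u i))) (P (EY.lsmul (star (u i)) (EY.rsmul x (u j)))) (u j)
      = t 1 (P (EY.lsmul (ι (EA.toFun (1 * u i)) * star (u i)) (EY.rsmul x (u j)))) (u j) := by
    intro i j
    rw [EY.mul_lsmul, h.P_lsmul, ← h.hup.balanced₁, one_mul, one_mul]
  simp only [e1]
  rw [Finset.sum_comm]
  simp only [← h.hup.sum₂, ← h.P_sum, ← EY.sum_lsmul]
  rw [(h.hu 1).2]
  simp only [EY.one_lsmul, h.P_rsmul_mem, h.hup.balanced₂]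
  rw [← h.hup.sum₃, h.quasi_one]

theorem phi_e (h : Lvl ι EA u ιC eA EY X MX P F t) (x : X) :
    F.rsmul (phiMap u EY P t x) eA = t 1 x 1 := by
  simp only [phiMap, F.sum_rsmul, h.hup.map_eB]
  have e1 : ∀ i j, t (u i) (P (EY.lsmul (star (u i)) (EY.rsmul x (u j)))) (ι (EA.toFun (u j)))
      = t (u i) (P (EY.lsmul (star (u i))
          (EY.rsmul x (u j * ι (EA.toFun (star (u j) * 1)))))) 1 := by
    intro i j
    rw [EY.rsmul_mul, ← EY.lsmul_rsmul (star (u i)) (EY.rsmul x (u j)), h.P_rsmul, h.hup.balanced₂, one_mul, mul_one,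
      EA.map_star, star_star]
  simp only [e1]
  simp only [← h.hup.sum₂, ← h.P_sum, ← EY.lsmul_sum, ← EY.rsmul_sum]
  rw [(h.hu 1).1]
  simp only [EY.rsmul_one, h.P_lsmul_mem, ← h.hup.balanced₁, EA.map_star]
  rw [← h.hup.sum₁, h.quasi_one]

theorem t_eq (h : Lvl ι EA u ιC eA EY X MX P F t) (c d : C) (x : X) :
    t c x d = F.rsmul (F.lsmul (ιC c) (t 1 x 1)) (ιC (star d)) := by
  rw [h.hup.map_lsmul, h.hup.map_rsmul, mul_one, mul_one, star_star]

/-- nondegeneracy of the range of `φ_Y` -/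
theorem nd_right (h : Lvl ι EA u ιC eA EY X MX P F t) (v : T)
    (hv : ∀ y, F.rinn (phiMap u EY P t y) v = 0) : v = 0 := by
  have h1 : ∀ c x d, F.rinn (t c x d) v = 0 := by
    intro c x d
    rw [h.t_eq, ← h.phi_e, ← F.lsmul_rsmul, ← h.phi_lsmul, ← F.rsmul_mul, F.rinn_rsmul_left, hv,
      mul_zero]
  have h2 : ∀ w, F.rinn v w = 0 := fun w =>
    h.hup.induction (f := F.rinnL v) (g := 0)
      (fun c x d => by
        rw [EquivBimodule.rinnL_apply, ← F.rinn_star, h1, star_zero]; rfl) w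
  exact F.rinn_definite v (h2 v)

theorem nd_left (h : Lvl ι EA u ιC eA EY X MX P F t) (v : T)
    (hv : ∀ y, F.linn v (phiMap u EY P t y) = 0) : v = 0 := by
  have h1 : ∀ c x d, F.linn v (t c x d) = 0 := by
    intro c x d
    rw [h.t_eq, F.lsmul_rsmul, ← h.e_phi, F.lsmul_rsmul, ← h.phi_rsmul, ← F.mul_lsmul,
      F.linn_lsmul_right, hv, zero_mul]
  have h2 : ∀ w, F.linn w v = 0 := fun w =>
    h.hup.induction (f := F.linnL v) (g := 0)
      (fun c x d => by
        rw [EquivBimodule.linnL_apply, ← F.linn_star, h1, star_zero]; rfl) w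
  exact F.linn_definite v (h2 v)

end Lvl

end Level

section Final

variable {A C C₁ C₂ : Type*} [CStarAlgebra A] [CStarAlgebra C] [CStarAlgebra C₁] [CStarAlgebra C₂]
    [PartialOrder A] [StarOrderedRing A] [PartialOrder C] [StarOrderedRing C]
    [PartialOrder C₁] [StarOrderedRing C₁] [PartialOrder C₂] [StarOrderedRing C₂]

/-- nondegeneracy of `X` in `Y`, from the density of the span of `⟨Y, X⟩` -/
theorem equiPair_ndr {Y : Type*} [NormedAddCommGroup Y] [NormedSpace ℂ Y] [CompleteSpace Y]
    {ι : A → C} {EY : EquivBimodule C C Y} {X : Submodule ℂ Y} (h : IsEquiPair ι EY X)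
    (v : Y) (hv : ∀ x ∈ X, EY.rinn x v = 0) : v = 0 := by
  have key : ∀ c : C, EY.lsmul c v = 0 := by
    intro c
    refine h.span_YX_left.induction (P := fun c => EY.lsmul c v = 0) ?_
      (isClosed_eq (EY.lactL v).continuous continuous_const) c
    intro d hd
    induction hd using Submodule.span_induction with
    | mem d h =>
      obtain ⟨y, x, hx, rfl⟩ := h
      rw [EY.imprimitivity, hv x hx, EY.rsmul_zero]
    | zero => rw [EY.zero_lsmul]
    | add a b _ _ ha hb => rw [EY.add_lsmul, ha, hb, add_zero]
    | smul z a _ ha => rw [EY.smul_lsmul, ha, smul_zero]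
  simpa only [EY.one_lsmul] using key 1

theorem equiPair_ndl {Y : Type*} [NormedAddCommGroup Y] [NormedSpace ℂ Y] [CompleteSpace Y]
    {ι : A → C} {EY : EquivBimodule C C Y} {X : Submodule ℂ Y} (h : IsEquiPair ι EY X)
    (v : Y) (hv : ∀ x ∈ X, EY.linn v x = 0) : v = 0 := by
  have key : ∀ c : C, EY.rsmul v (star c) = 0 := by
    intro c
    refine h.span_YX_right.induction (P := fun c => EY.rsmul v (star c) = 0) ?_
      (isClosed_eq ((EY.ractL v).continuous.comp continuous_star) continuous_const) c
    intro d hd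
    induction hd using Submodule.span_induction with
    | mem d h =>
      obtain ⟨y, x, hx, rfl⟩ := h
      rw [EY.rinn_star, ← EY.imprimitivity, hv x hx, EY.zero_lsmul]
    | zero => rw [star_zero, EY.rsmul_zero]
    | add a b _ _ ha hb => rw [star_add, EY.rsmul_add, ha, hb, add_zero]
    | smul z a _ ha => rw [star_smul, EY.smul_rsmul, ha, smul_zero]
  simpa only [star_one, EY.rsmul_one] using key 1

/-- the Jones relation `e_A = r e_A e_C e_A` -/
theorem jones_relation {ι : A →⋆ₐ[ℂ] C} {EA : CondExpectation ι} {n : ℕ} {u : Fin n → C}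
    (hu : IsQuasiBasis EA u) {r : ℝ} (hr : 0 < r)
    {ιC : C →⋆ₐ[ℂ] C₁} {eA : C₁} (hbc : IsBasicConstruction ι EA ιC eA)
    {EC : CondExpectation ιC}
    {w : Fin n → C₁} (hw : ∀ i, w i = (Real.sqrt r : ℂ) • (ιC (u i) * eA))
    (hwqb : IsQuasiBasis EC w)
    {ιC1 : C₁ →⋆ₐ[ℂ] C₂} {eC : C₂} (hbc2 : IsBasicConstruction ιC EC ιC1 eC) :
    ιC1 eA = (r : ℂ) • (ιC1 eA * eC * ιC1 eA) := by
  have h1 := hbc2.sum_one hwqb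
  have hsq : (Real.sqrt r : ℂ) * (Real.sqrt r : ℂ) = r := by
    rw [← Complex.ofReal_mul, Real.mul_self_sqrt hr.le]
  have hX : ∀ i, ιC1 eA * (ιC1 (w i) * eC * ιC1 (star (w i))) * ιC1 eA =
      (r : ℂ) • (ιC1 eA * eC * ιC1 (ιC (ι (EA.toFun (u i) * EA.toFun (star (u i))))) * ιC1 eA) := by
    intro i
    have a1 : eA * w i = (Real.sqrt r : ℂ) • (eA * ιC (ι (EA.toFun (u i)))) := by
      rw [hw, mul_smul_comm, ← mul_assoc, hbc.expect, hbc.comm]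
    have a2 : star (w i) * eA = (Real.sqrt r : ℂ) • (ιC (ι (EA.toFun (star (u i)))) * eA) := by
      rw [hw, star_smul, star_mul, hbc.selfadj, smul_mul_assoc, ← map_star, hbc.expect]
      simp
    have a3 := hbc2.comm (ι (EA.toFun (u i)))
    calc _ = ιC1 (eA * w i) * eC * ιC1 (star (w i) * eA) := by
          simp only [map_mul, mul_assoc]
      _ = (r : ℂ) • (ιC1 eA * (ιC1 (ιC (ι (EA.toFun (u i)))) * eC) *
            ιC1 (ιC (ι (EA.toFun (star (u i))))) * ιC1 eA) := by
          rw [a1, a2]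
          simp only [map_smul, smul_mul_assoc, mul_smul_comm, smul_smul, hsq, map_mul, mul_assoc]
      _ = _ := by
          rw [a3]
          simp only [map_mul, mul_assoc]
  have hone : ∑ i, EA.toFun (u i) * EA.toFun (star (u i)) = 1 := by
    have h2 := (hu 1).1
    have h3 : EA.toFun 1 = 1 := by simpa using EA.retraction 1
    have h4 : EA.toFun (∑ i, u i * ι (EA.toFun (star (u i) * 1))) =
        ∑ i, EA.toFun (u i * ι (EA.toFun (star (u i) * 1))) :=
      map_sum (AddMonoidHom.mk' EA.toFun EA.map_add) _ _
    rw [h2, h3] at h4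
    simp only [EA.right_mod, mul_one] at h4
    exact h4.symm
  have idem : ιC1 eA * ιC1 eA = ιC1 eA := by rw [← map_mul, hbc.idem]
  calc ιC1 eA = ιC1 eA * (∑ i, ιC1 (w i) * eC * ιC1 (star (w i))) * ιC1 eA := by
        rw [h1, mul_one, idem]
    _ = (r : ℂ) • (ιC1 eA * eC * ιC1 (ιC (ι (∑ i, EA.toFun (u i) * EA.toFun (star (u i)))))
          * ιC1 eA) := by
        rw [Finset.mul_sum, Finset.sum_mul]
        simp only [hX]
        rw [← Finset.smul_sum]
        simp only [map_sum, Finset.mul_sum, Finset.sum_mul]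
    _ = _ := by rw [hone]; simp

end Final



/-- Let `A ⊆ C` be a unital inclusion with `A' ∩ C = ℂ1`, `E^A` of
index-finite type, `C₁` its basic construction, `E^C` the dual conditional expectation
and `C₂` the basic construction of `E^C`.  With `f([X,Y]) = [Y,Y₁]`,
`f₁([Y,Y₁]) = [Y₁,Y₂]` (upward basic constructions) and
`g([X,Y]) = [C ⊗_A X ⊗_A C̃, C₁ ⊗_C Y ⊗_C C̃₁]`, one has `f₁ ∘ f = g` on `Pic(A,C)`. -/
theorem f_one_comp_f_eq_g
    {A C C₁ C₂ Yt T T₂ VG : Type*}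
    [CStarAlgebra A] [CStarAlgebra C] [CStarAlgebra C₁] [CStarAlgebra C₂]
    [PartialOrder A] [StarOrderedRing A] [PartialOrder C] [StarOrderedRing C]
    [PartialOrder C₁] [StarOrderedRing C₁] [PartialOrder C₂] [StarOrderedRing C₂]
    [NormedAddCommGroup Yt] [NormedSpace ℂ Yt] [CompleteSpace Yt]
    [NormedAddCommGroup T] [NormedSpace ℂ T] [CompleteSpace T]
    [NormedAddCommGroup T₂] [NormedSpace ℂ T₂] [CompleteSpace T₂]
    [NormedAddCommGroup VG] [NormedSpace ℂ VG] [CompleteSpace VG]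
    (ι : A →⋆ₐ[ℂ] C) (hι : Function.Injective ι)
    (EA : CondExpectation ι) {n : ℕ} (u : Fin n → C) (hu : IsQuasiBasis EA u)
    (hirr : IrreducibleIncl ι)
    -- the Watatani index `Ind_W(E^A) = r·1` (a scalar since `A' ∩ C = ℂ1`)
    (r : ℝ) (hr : 0 < r) (hInd : ∑ i, u i * star (u i) = (r : ℂ) • (1 : C))
    -- the basic construction `C₁` and the dual conditional expectation `E^C`
    (ιC : C →⋆ₐ[ℂ] C₁) (eA : C₁) (hbc : IsBasicConstruction ι EA ιC eA)
    (EC : CondExpectation ιC)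
    (hEC : ∀ c d : C, EC.toFun (ιC c * eA * ιC d) = (r⁻¹ : ℂ) • (c * d))
    -- the quasi-basis `w_i = √r · u_i e_A` for `E^C`
    (w : Fin n → C₁) (hw : ∀ i, w i = (Real.sqrt r : ℂ) • (ιC (u i) * eA))
    (hwqb : IsQuasiBasis EC w)
    -- the second basic construction `C₂`
    (ιC1 : C₁ →⋆ₐ[ℂ] C₂) (eC : C₂) (hbc2 : IsBasicConstruction ιC EC ιC1 eC)
    -- an element `(X, Y) ∈ Equi(A, C)`
    (EY : EquivBimodule C C Yt) (X : Submodule ℂ Yt) (hpair : IsEquiPair ⇑ι EY X)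
    [CompleteSpace X] (MX : EquivBimodule A A X) (hMX : IsRestriction ⇑ι ⇑ι EY X MX)
    (EX : Yt → Yt) (hEX : IsBimodCondExp ι ι EA EA EY X EX)
    -- the upward basic construction `Y₁` of `Y`
    (F : EquivBimodule C₁ C₁ T) (t : C → X → C → T)
    (hup : IsUpwardBasic ι ι EA EA MX ιC eA ιC eA F t)
    -- `Y` regarded as the closed subspace `φ_Y(Y)` of `Y₁`
    (Ysub : Submodule ℂ T)
    (hYsub : Ysub = (Submodule.span ℂ (Set.range fun y : Yt => ∑ i, ∑ j, t (u i)
      ⟨EX (EY.lsmul (star (u i)) (EY.rsmul y (u j))), hEX.mem _⟩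
      (u j))).topologicalClosure)
    [CompleteSpace Ysub] (MY : EquivBimodule C C Ysub)
    (hMY : IsRestriction ⇑ιC ⇑ιC F Ysub MY)
    -- the (unique) conditional expectation `E^Y : Y₁ → Y`
    (EY1 : T → T) (hEY1 : IsBimodCondExp ιC ιC EC EC F Ysub EY1)
    -- the upward basic construction `Y₂` of `Y₁`
    (F₂ : EquivBimodule C₂ C₂ T₂) (t₂ : C₁ → Ysub → C₁ → T₂)
    (hup2 : IsUpwardBasic ιC ιC EC EC MY ιC1 eC ιC1 eC F₂ t₂)
    -- the realization `C₁ ⊗_C Y ⊗_C C̃₁` of `g([X, Y])`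
    (G : EquivBimodule C₂ C₂ VG) (rg : C₁ → Yt → C₁ → VG)
    (hg : IsUpwardBasic ιC ιC EC EC EY ιC1 eC ιC1 eC G rg) :
    -- `f₁(f([X,Y])) = g([X,Y])` in `Pic(C₁, C₂)`
    PairEquiv F₂
      ((Submodule.span ℂ (Set.range fun y₁ : T => ∑ i, ∑ j, t₂ (w i)
        ⟨EY1 (F.lsmul (star (w i)) (F.rsmul y₁ (w j))), hEY1.mem _⟩
        (w j))).topologicalClosure)
      G
      ((Submodule.span ℂ {v : VG | ∃ c d : C, ∃ x ∈ X,
        v = (r : ℂ) • rg (ιC c * eA) x (ιC d * eA)}).topologicalClosure) := by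
  have L1 : Lvl ι EA u ιC eA EY X MX (fun y => ⟨EX y, hEX.mem y⟩) F t :=
    ⟨hu, hbc, hMX, hEX, hup, equiPair_ndl hpair, equiPair_ndr hpair⟩
  have hrange : Ysub = LinearMap.range L1.phiL.toLinearMap := by
    have h0 : Ysub = (Submodule.span ℂ (Set.range L1.phiL)).topologicalClosure := hYsub
    rw [h0]
    have h1 : Submodule.span ℂ (Set.range L1.phiL) = LinearMap.range L1.phiL.toLinearMap :=
      Submodule.span_eq (LinearMap.range L1.phiL.toLinearMap)
    rw [h1]
    apply IsClosed.submodule_topologicalClosure_eq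
    exact L1.phiL.isometry.isClosedEmbedding.isClosed_range
  have hmem : ∀ y, L1.phiL y ∈ Ysub := by
    intro y; rw [hrange]; exact ⟨y, rfl⟩
  have L2 : Lvl ιC EC w ιC1 eC F Ysub MY (fun y => ⟨EY1 y, hEY1.mem y⟩) F₂ t₂ :=
    ⟨hwqb, hbc2, hMY, hEY1, hup2, fun v hv => L1.nd_left v (fun y => hv _ (hmem y)),
      fun v hv => L1.nd_right v (fun y => hv _ (hmem y))⟩
  let φ : Yt → Ysub := fun y => ⟨L1.phiL y, hmem y⟩
  have hφs : Function.Surjective φ := by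
    rintro ⟨v, hv⟩
    have hv' := hv
    rw [hrange] at hv'
    obtain ⟨y, hy⟩ := hv'
    exact ⟨y, Subtype.ext hy⟩
  have φl : ∀ c y, φ (EY.lsmul c y) = MY.lsmul c (φ y) := fun c y =>
    Subtype.ext ((L1.phi_lsmul c y).trans (hMY.lsmul_coe c (φ y)).symm)
  have φr : ∀ y c, φ (EY.rsmul y c) = MY.rsmul (φ y) c := fun y c =>
    Subtype.ext ((L1.phi_rsmul c y).trans (hMY.rsmul_coe (φ y) c).symm)
  have φli : ∀ y y', MY.linn (φ y) (φ y') = EY.linn y y' := fun y y' =>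
    hbc.inj ((hMY.linn_coe _ _).trans (L1.phi_linn y y'))
  have φri : ∀ y y', MY.rinn (φ y) (φ y') = EY.rinn y y' := fun y y' =>
    hbc.inj ((hMY.rinn_coe _ _).trans (L1.phi_rinn y y'))
  have φa : ∀ y y', φ (y + y') = φ y + φ y' := fun y y' => Subtype.ext (map_add L1.phiL y y')
  have φm : ∀ (z : ℂ) y, φ (z • y) = z • φ y := fun z y => Subtype.ext (map_smul L1.phiL z y)
  have hup2' : IsUpwardBasic ιC ιC EC EC EY ιC1 eC ιC1 eC F₂ (fun c y d => t₂ c (φ y) d) := by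
    refine ⟨?_, ?_, ?_, ?_, ?_, ?_, ?_, ?_, ?_, ?_, ?_, ?_, ?_, ?_, ?_⟩
    · intros; exact hup2.add₁ _ _ _ _
    · intros; exact hup2.smul₁ _ _ _ _
    · intro c x x' d; rw [φa]; exact hup2.add₂ _ _ _ _
    · intro z c x d; rw [φm]; exact hup2.smul₂ _ _ _ _
    · intros; exact hup2.add₃ _ _ _ _
    · intros; exact hup2.smul₃ _ _ _ _
    · intro a c x d; rw [φl]; exact hup2.balanced₁ _ _ _ _
    · intro a c x d; rw [φr]; exact hup2.balanced₂ _ _ _ _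
    · intros; exact hup2.map_lsmul _ _ _ _
    · intros; exact hup2.map_eA _ _ _
    · intros; exact hup2.map_rsmul _ _ _ _
    · intros; exact hup2.map_eB _ _ _
    · intro c c' x x' d d'; rw [hup2.linn_eq, ← φr, φli]
    · intro c c' x x' d d'; rw [hup2.rinn_eq, ← φl, φri]
    · have e : {v : T₂ | ∃ c y d, v = t₂ c (φ y) d} = {v : T₂ | ∃ c y d, v = t₂ c y d} := by
        ext v
        constructor
        · rintro ⟨c, y, d, rfl⟩; exact ⟨_, _, _, rfl⟩
        · rintro ⟨c, y, d, rfl⟩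
          obtain ⟨y, rfl⟩ := hφs y
          exact ⟨_, _, _, rfl⟩
      rw [e]; exact hup2.dense
  obtain ⟨Ψ, Φ, hΦ, hΨ⟩ := upward_unique hbc2 hup2' hg
  have hJ := jones_relation hu hr hbc hw hwqb hbc2
  -- the image of elementary tensors
  have key0 : ∀ x : X, L2.phiL (t 1 x 1) = (r : ℂ) • t₂ eA (φ x) eA := by
    intro x
    have b1 : L2.phiL (t 1 x 1) = F₂.rsmul (L2.phiL (φ x : T)) (ιC1 eA) := by
      rw [← L1.phi_e x]; exact L2.phi_rsmul eA _
    have b2 : L2.phiL (t 1 x 1) = F₂.lsmul (ιC1 eA) (L2.phiL (φ x : T)) := by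
      rw [← L1.e_phi x]; exact L2.phi_lsmul eA _
    have b3 : F₂.rsmul (L2.phiL (φ x : T)) eC = t₂ 1 (φ x) 1 := L2.phi_e (φ x)
    calc L2.phiL (t 1 x 1) = F₂.rsmul (L2.phiL (φ x : T)) (ιC1 eA) := b1
      _ = (r : ℂ) • F₂.rsmul (F₂.rsmul (F₂.rsmul (L2.phiL (φ x : T)) (ιC1 eA)) eC) (ιC1 eA) := by
          conv_lhs => rw [hJ]
          rw [F₂.smul_rsmul, F₂.rsmul_mul, F₂.rsmul_mul]
      _ = (r : ℂ) • F₂.rsmul (F₂.lsmul (ιC1 eA) (t₂ 1 (φ x) 1)) (ιC1 eA) := by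
          rw [← b1, b2, F₂.lsmul_rsmul, b3]
      _ = _ := by
          rw [hup2.map_lsmul, hup2.map_rsmul, mul_one, mul_one, hbc.selfadj]
  have key : ∀ c (x : X) d, Ψ (L2.phiL (t c x d)) = (r : ℂ) • rg (ιC c * eA) x (ιC d * eA) := by
    intro c x d
    rw [L1.t_eq, L2.phiL_apply, L2.phi_rsmul, L2.phi_lsmul, ← L2.phiL_apply, key0,
      F₂.lsmul_smul, F₂.rsmul_smul, hup2.map_lsmul, hup2.map_rsmul, map_smul, map_star, star_star]
    rw [← hΨ]
  refine ⟨Φ, ?_⟩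
  rw [hΦ]
  let Q : T →ₗᵢ[ℂ] VG := Ψ.toLinearIsometry.comp L2.phiL
  have hQ : ∀ c (x : X) d, Q (t c x d) = (r : ℂ) • rg (ιC c * eA) x (ιC d * eA) := key
  have hleft : Submodule.map Ψ.toLinearEquiv.toLinearMap
      (Submodule.span ℂ (Set.range L2.phiL)).topologicalClosure =
      (Submodule.span ℂ (Set.range Q)).topologicalClosure := by
    apply SetLike.coe_injective
    rw [Submodule.map_coe, Submodule.topologicalClosure_coe, Submodule.topologicalClosure_coe]
    have e1 := Ψ.toHomeomorph.image_closure
      (Submodule.span ℂ (Set.range L2.phiL) : Set T₂)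
    have e2 : Ψ.toHomeomorph '' (Submodule.span ℂ (Set.range L2.phiL) : Set T₂) =
        (Submodule.span ℂ (Set.range Q) : Set VG) := by
      have e3 : Submodule.span ℂ (Set.range Q) = Submodule.map Ψ.toLinearEquiv.toLinearMap
          (Submodule.span ℂ (Set.range L2.phiL)) := by
        rw [Submodule.map_span, ← Set.range_comp]
        rfl
      rw [e3, Submodule.map_coe]
      rfl
    rw [e2] at e1
    exact e1
  refine Eq.trans hleft ?_
  apply le_antisymm
  · apply Submodule.topologicalClosure_minimal _ _ (Submodule.isClosed_topologicalClosure _)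
    rw [Submodule.span_le]
    rintro _ ⟨v, rfl⟩
    refine hup.denseRange.induction_on
      (p := fun v => Q v ∈ (Submodule.span ℂ {v : VG | ∃ c d : C, ∃ x ∈ X,
        v = (r : ℂ) • rg (ιC c * eA) x (ιC d * eA)}).topologicalClosure) v
      ((Submodule.isClosed_topologicalClosure _).preimage Q.continuous) ?_
    intro a
    induction a using Finsupp.induction_linear with
    | zero => simp only [map_zero]; exact Submodule.zero_mem _
    | add a b ha hb => simp only [map_add]; exact Submodule.add_mem _ ha hb
    | single p z =>
      rw [combL_single, map_smul, hQ]
      apply Submodule.smul_mem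
      apply Submodule.le_topologicalClosure
      exact Submodule.subset_span ⟨_, _, _, p.2.1.2, rfl⟩
  · apply Submodule.topologicalClosure_mono
    apply Submodule.span_mono
    rintro _ ⟨c, d, x, hx, rfl⟩
    exact ⟨t c ⟨x, hx⟩ d, hQ c ⟨x, hx⟩ d⟩

end
end
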